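/- arXiv:1912.03900 — 2 statements merged into one kernel-verified Lean document; each statement's English description precedes it below -/
import Mathlib

section
/- For every integer d ≥ 4, every 2-neighborly d-polytope with exactly d+3 vertices has at least d+7 facets. -/
open Set

/-- A polytope is the convex hull of a finite set of points. -/
def IsPolytope {N : ℕ} (P : Set (Fin N → ℝ)) : Prop :=
  ∃ S : Finset (Fin N → ℝ), P = convexHull ℝ (S : Set (Fin N → ℝ))

/-- The dimension of a set: the dimension of its affine span. -/
noncomputable def pdim {N : ℕ} (P : Set (Fin N → ℝ)) : ℕ :=
  Module.finrank ℝ (affineSpan ℝ P).direction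

/-- A vertex is a 0-dimensional (exposed) face, i.e. an exposed singleton. -/
def IsVertex {N : ℕ} (P : Set (Fin N → ℝ)) (v : Fin N → ℝ) : Prop :=
  IsExposed ℝ P {v}

/-- The set of vertices of `P`. -/
def vertexSet {N : ℕ} (P : Set (Fin N → ℝ)) : Set (Fin N → ℝ) :=
  {v | IsVertex P v}

/-- A facet is a nonempty exposed face of dimension one less than the polytope. -/
def IsFacetOf {N : ℕ} (P F : Set (Fin N → ℝ)) : Prop :=
  IsExposed ℝ P F ∧ F.Nonempty ∧ pdim F + 1 = pdim P

/-- The set of facets of `P`. -/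
def facetSet {N : ℕ} (P : Set (Fin N → ℝ)) : Set (Set (Fin N → ℝ)) :=
  {F | IsFacetOf P F}

/-- A polytope is 2-neighborly if every pair of distinct vertices is the vertex set of
an edge (1-dimensional face), i.e. the segment between them is an exposed face. -/
def TwoNeighborly {N : ℕ} (P : Set (Fin N → ℝ)) : Prop :=
  ∀ u v : Fin N → ℝ, IsVertex P u → IsVertex P v → u ≠ v →
    IsExposed ℝ P (convexHull ℝ {u, v}) ∧ pdim (convexHull ℝ ({u, v} : Set (Fin N → ℝ))) = 1

/-- A polytope is 2-simplicial if every 2-dimensional face has exactly 3 vertices. -/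
def TwoSimplicial {N : ℕ} (P : Set (Fin N → ℝ)) : Prop :=
  ∀ F : Set (Fin N → ℝ), IsExposed ℝ P F → F.Nonempty → pdim F = 2 →
    (vertexSet F).ncard = 3

/-- A polytope is a pyramid if some vertex (the apex) is not in the affine span
of the remaining vertices. -/
def IsPyramid {N : ℕ} (P : Set (Fin N → ℝ)) : Prop :=
  ∃ v : Fin N → ℝ, IsVertex P v ∧ v ∉ affineSpan ℝ (vertexSet P \ {v})

/-- `P` is a pyramid over `Q`: `Q` is a facet of `P` and `P` is the convex hull of `Q`
together with one additional point (the apex) not in the affine span of `Q`. -/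
def IsPyramidOver {N : ℕ} (P Q : Set (Fin N → ℝ)) : Prop :=
  IsFacetOf P Q ∧ ∃ a : Fin N → ℝ, a ∉ affineSpan ℝ Q ∧ P = convexHull ℝ (Q ∪ {a})

/-- `P` is a `k`-fold pyramid over `Q`. -/
def IsKFoldPyramidOver {N : ℕ} : ℕ → Set (Fin N → ℝ) → Set (Fin N → ℝ) → Prop
  | 0, P, Q => P = Q
  | k + 1, P, Q => ∃ R : Set (Fin N → ℝ), IsKFoldPyramidOver k R Q ∧ IsPyramidOver P R

section PlanarConfigurations

open scoped Finset

/-- The determinant of two plane vectors. -/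
def cross (p q : ℝ × ℝ) : ℝ := p.1 * q.2 - p.2 * q.1

/-- The standard scalar product of two plane vectors. -/
def dot (p q : ℝ × ℝ) : ℝ := p.1 * q.1 + p.2 * q.2

lemma cross_swap (p q : ℝ × ℝ) : cross q p = -cross p q := by
  unfold cross; ring

lemma cross_self_eq_zero (p : ℝ × ℝ) : cross p p = 0 := by
  unfold cross; ring

lemma dot_comm (p q : ℝ × ℝ) : dot p q = dot q p := by
  unfold dot; ring

lemma dot_self_nonneg (p : ℝ × ℝ) : 0 ≤ dot p p :=
  add_nonneg (mul_self_nonneg _) (mul_self_nonneg _)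

lemma dot_self_pos {p : ℝ × ℝ} (hp : p ≠ 0) : 0 < dot p p := by
  have h : p.1 ≠ 0 ∨ p.2 ≠ 0 := by
    by_contra! h
    exact hp (Prod.ext h.1 h.2)
  unfold dot
  rcases h with h | h
  · exact add_pos_of_pos_of_nonneg (mul_self_pos.2 h) (mul_self_nonneg _)
  · exact add_pos_of_nonneg_of_pos (mul_self_nonneg _) (mul_self_pos.2 h)

lemma dot_self_mul_cross (p a b : ℝ × ℝ) :
    dot p p * cross a b = dot p a * cross p b - cross p a * dot p b := by
  unfold dot cross; ring

lemma dot_self_mul_dot (p a b : ℝ × ℝ) :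
    dot p p * dot a b = dot p a * dot p b + cross p a * cross p b := by
  unfold dot cross; ring

variable {ι : Type*} [Fintype ι] [DecidableEq ι]

/-- `C` is the support of a positive linear relation among the vectors `g i`, and this relation is
up to scaling the only one supported in `C`. -/
def IsPosCircuit (g : ι → ℝ × ℝ) (C : Finset ι) : Prop :=
  ∃ w : ι → ℝ, (∀ i ∈ C, 0 < w i) ∧ (∀ i ∉ C, w i = 0) ∧ ∑ i, w i • g i = 0 ∧
    ∀ u : ι → ℝ, (∀ i ∉ C, u i = 0) → ∑ i, u i • g i = 0 → ∃ t : ℝ, u = t • w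

/-- The three vectors have the origin in the interior of their convex hull, in
counterclockwise order. -/
def Cyclic (g : ι → ℝ × ℝ) (i a b : ι) : Prop :=
  0 < cross (g i) (g a) ∧ 0 < cross (g a) (g b) ∧ 0 < cross (g b) (g i)

/-- The two vectors point in opposite directions. -/
def Antipodal (g : ι → ℝ × ℝ) (i j : ι) : Prop :=
  cross (g i) (g j) = 0 ∧ dot (g i) (g j) < 0

lemma Antipodal.symm {ι : Type*} {g : ι → ℝ × ℝ} {i j : ι} (h : Antipodal g i j) : Antipodal g j i :=
  ⟨by rw [cross_swap, h.1, neg_zero], by rw [dot_comm]; exact h.2⟩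

lemma isPosCircuit_singleton {g : ι → ℝ × ℝ} {i : ι} (hi : g i = 0) :
    IsPosCircuit g {i} := by
  refine ⟨Pi.single i 1, by simp, fun j hj => ?_, ?_, fun u hu _ => ⟨u i, ?_⟩⟩
  · rw [Finset.mem_singleton] at hj
    simp [hj]
  · rw [Finset.sum_eq_single i] <;> simp +contextual [hi]
  · ext j
    by_cases h : j = i
    · subst h; simp
    · simp [h, hu j (by simpa using h)]

lemma isPosCircuit_pair {g : ι → ℝ × ℝ} {i j : ι} (h : Antipodal g i j) :
    IsPosCircuit g {i, j} := by
  obtain ⟨hc, hd⟩ := h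
  have hij : i ≠ j := by
    rintro rfl
    exact absurd hd (not_lt.2 (dot_self_nonneg _))
  have hi : g i ≠ 0 := by
    intro h0; simp [h0, dot] at hd
  have hi0 := dot_self_pos hi
  have hsum : ∀ u : ι → ℝ, (∀ k ∉ ({i, j} : Finset ι), u k = 0) →
      ∑ k, u k • g k = u i • g i + u j • g j := by
    intro u hu
    rw [← Finset.sum_subset (Finset.subset_univ {i, j}) (fun k _ hk => by rw [hu k hk, zero_smul]),
      Finset.sum_pair hij]
  let w : ι → ℝ := fun k => if k = i then -dot (g i) (g j) else
    if k = j then dot (g i) (g i) else 0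
  have wi : w i = -dot (g i) (g j) := by simp [w]
  have wj : w j = dot (g i) (g i) := by simp [w, hij.symm]
  have w0 : ∀ k ∉ ({i, j} : Finset ι), w k = 0 := by
    intro k hk
    simp only [Finset.mem_insert, Finset.mem_singleton, not_or] at hk
    simp [w, hk]
  refine ⟨w, ?_, w0, ?_, ?_⟩
  · intro k hk
    simp only [Finset.mem_insert, Finset.mem_singleton] at hk
    rcases hk with rfl | rfl
    · rw [wi]; linarith
    · rw [wj]; exact hi0
  · rw [hsum w w0, wi, wj]
    unfold cross at hc
    ext
    · simp only [dot, Prod.fst_add, Prod.smul_fst, smul_eq_mul, Prod.fst_zero]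
      linear_combination -(g i).2 * hc
    · simp only [dot, Prod.snd_add, Prod.smul_snd, smul_eq_mul, Prod.snd_zero]
      linear_combination (g i).1 * hc
  · intro u hu h0
    rw [hsum u hu] at h0
    have h1 := congrArg Prod.fst h0
    have h2 := congrArg Prod.snd h0
    simp only [Prod.fst_add, Prod.smul_fst, smul_eq_mul, Prod.fst_zero, Prod.snd_add,
      Prod.smul_snd, Prod.snd_zero] at h1 h2
    refine ⟨u j / dot (g i) (g i), ?_⟩
    ext k
    simp only [Pi.smul_apply, smul_eq_mul]
    by_cases hki : k = i
    · subst hki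
      rw [wi]
      field_simp
      unfold dot
      linear_combination (g k).1 * h1 + (g k).2 * h2
    by_cases hkj : k = j
    · subst hkj
      rw [wj]
      field_simp
    · have : k ∉ ({i, j} : Finset ι) := by simp [hki, hkj]
      rw [hu k this, w0 k this, mul_zero]

lemma Cyclic.ne {ι : Type*} {g : ι → ℝ × ℝ} {i a b : ι} (h : Cyclic g i a b) :
    i ≠ a ∧ a ≠ b ∧ b ≠ i := by
  obtain ⟨h1, h2, h3⟩ := h
  refine ⟨?_, ?_, ?_⟩ <;> rintro rfl <;> simp_all [cross_self_eq_zero]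

lemma isPosCircuit_triple {g : ι → ℝ × ℝ} {i a b : ι} (h : Cyclic g i a b) :
    IsPosCircuit g {i, a, b} := by
  obtain ⟨hia, hab, hbi⟩ := h.ne
  obtain ⟨h1, h2, h3⟩ := h
  have hsum : ∀ u : ι → ℝ, (∀ k ∉ ({i, a, b} : Finset ι), u k = 0) →
      ∑ k, u k • g k = u i • g i + (u a • g a + u b • g b) := by
    intro u hu
    rw [← Finset.sum_subset (Finset.subset_univ {i, a, b}) (fun k _ hk => by rw [hu k hk, zero_smul]),
      Finset.sum_insert (by simp [hia, hbi.symm]), Finset.sum_pair hab]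
  let w : ι → ℝ := fun k => if k = i then cross (g a) (g b) else
    if k = a then cross (g b) (g i) else if k = b then cross (g i) (g a) else 0
  have wi : w i = cross (g a) (g b) := by simp [w]
  have wa : w a = cross (g b) (g i) := by simp [w, hia.symm]
  have wb : w b = cross (g i) (g a) := by simp [w, hab.symm, hbi]
  have w0 : ∀ k ∉ ({i, a, b} : Finset ι), w k = 0 := by
    intro k hk
    simp only [Finset.mem_insert, Finset.mem_singleton, not_or] at hk
    simp [w, hk]
  refine ⟨w, ?_, w0, ?_, ?_⟩
  · intro k hk
    simp only [Finset.mem_insert, Finset.mem_singleton] at hk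
    rcases hk with rfl | rfl | rfl
    · rwa [wi]
    · rwa [wa]
    · rwa [wb]
  · rw [hsum w w0, wi, wa, wb]
    ext
    · simp only [cross, Prod.fst_add, Prod.smul_fst, smul_eq_mul, Prod.fst_zero]
      ring
    · simp only [cross, Prod.snd_add, Prod.smul_snd, smul_eq_mul, Prod.snd_zero]
      ring
  · intro u hu h0
    rw [hsum u hu] at h0
    have e1 := congrArg Prod.fst h0
    have e2 := congrArg Prod.snd h0
    simp only [Prod.fst_add, Prod.smul_fst, smul_eq_mul, Prod.fst_zero, Prod.snd_add,
      Prod.smul_snd, Prod.snd_zero] at e1 e2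
    refine ⟨u i / cross (g a) (g b), ?_⟩
    ext k
    simp only [Pi.smul_apply, smul_eq_mul]
    by_cases hki : k = i
    · subst hki
      rw [wi]
      field_simp
    by_cases hka : k = a
    · subst hka
      rw [wa]
      field_simp
      unfold cross
      linear_combination (g b).2 * e1 - (g b).1 * e2
    by_cases hkb : k = b
    · subst hkb
      rw [wb]
      field_simp
      unfold cross
      linear_combination (g a).1 * e2 - (g a).2 * e1
    · have : k ∉ ({i, a, b} : Finset ι) := by simp [hki, hka, hkb]
      rw [hu k this, w0 k this, mul_zero]

/-- If each `c a` is at least `k` minus the number of elements preceding `a`, then the three first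
elements have a large total. -/
lemma sum_ge_of_three_le_card {α : Type*} [DecidableEq α] (s : Finset α) (r : α → ℝ)
    (c : α → ℕ) (k : ℕ)
    (hs : 3 ≤ #s) (hc : ∀ a ∈ s, k ≤ c a + #{b ∈ s | r b < r a}) :
    k + (k - 1) + (k - 2) ≤ ∑ a ∈ s, c a := by
  obtain ⟨a₁, h₁, m₁⟩ := s.exists_min_image r (Finset.card_pos.1 (by omega))
  have e₁ := Finset.card_erase_of_mem h₁
  obtain ⟨a₂, h₂, m₂⟩ := (s.erase a₁).exists_min_image r (Finset.card_pos.1 (by omega))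
  have e₂ := Finset.card_erase_of_mem h₂
  obtain ⟨a₃, h₃, m₃⟩ := ((s.erase a₁).erase a₂).exists_min_image r (Finset.card_pos.1 (by omega))
  have b₁ : #{b ∈ s | r b < r a₁} = 0 := by
    rw [Finset.card_eq_zero, Finset.filter_eq_empty_iff]
    exact fun x hx => not_lt.2 (m₁ x hx)
  have b₂ : #{b ∈ s | r b < r a₂} ≤ 1 := by
    refine (Finset.card_le_card (t := {a₁}) fun x hx => ?_).trans (by simp)
    rw [Finset.mem_filter] at hx
    by_contra hne
    exact absurd hx.2 (not_lt.2 (m₂ x (Finset.mem_erase.2 ⟨by simpa using hne, hx.1⟩)))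
  have b₃ : #{b ∈ s | r b < r a₃} ≤ 2 := by
    refine (Finset.card_le_card (t := {a₁, a₂}) fun x hx => ?_).trans Finset.card_le_two
    rw [Finset.mem_filter] at hx
    by_contra hne
    simp only [Finset.mem_insert, Finset.mem_singleton, not_or] at hne
    exact absurd hx.2 (not_lt.2 (m₃ x (Finset.mem_erase.2 ⟨hne.2, Finset.mem_erase.2 ⟨hne.1, hx.1⟩⟩)))
  rw [Finset.mem_erase] at h₂
  rw [Finset.mem_erase, Finset.mem_erase] at h₃
  have c₁ := hc a₁ h₁
  have c₂ := hc a₂ h₂.2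
  have c₃ := hc a₃ h₃.2.2
  have hsub : ({a₁, a₂, a₃} : Finset α) ⊆ s := by
    simp [Finset.insert_subset_iff, h₁, h₂.2, h₃.2.2]
  have := Finset.sum_le_sum_of_subset (f := c) hsub
  rw [Finset.sum_insert (by simp [h₂.1.symm, h₃.2.1.symm]), Finset.sum_pair h₃.1.symm] at this
  omega

open Classical in
/-- The number of antipodes of a vector. -/
noncomputable def antipodalCount (g : ι → ℝ × ℝ) (i : ι) : ℕ := #{j | Antipodal g i j}

open Classical in
/-- The number of positive triangles through a vector. -/
noncomputable def cyclicCount (g : ι → ℝ × ℝ) (i : ι) : ℕ :=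
  #{p : ι × ι | Cyclic g i p.1 p.2}

/-- Every open half plane bounded by a line through the origin contains at least three of the
vectors. -/
def ThreeBalanced (g : ι → ℝ × ℝ) : Prop :=
  ∀ u : ℝ × ℝ, u ≠ 0 → 3 ≤ #{j | 0 < cross u (g j)}

lemma ThreeBalanced.card_neg {ι : Type*} [Fintype ι] {g : ι → ℝ × ℝ} (hg : ThreeBalanced g)
    {u : ℝ × ℝ} (hu : u ≠ 0) :
    3 ≤ #{j | cross u (g j) < 0} := by
  have := hg (-u) (neg_ne_zero.2 hu)
  have h : ∀ p, cross (-u) p = -cross u p := fun p => by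
    simp only [cross, Prod.fst_neg, Prod.snd_neg]; ring
  simpa only [h, Left.neg_pos_iff] using this

lemma ThreeBalanced.cyclicCount_ge {g : ι → ℝ × ℝ} (hg : ThreeBalanced g) {i : ι}
    (hi : g i ≠ 0) :
    (3 - antipodalCount g i) + (3 - antipodalCount g i - 1) + (3 - antipodalCount g i - 2) ≤
      cyclicCount g i := by
  classical
  set s : Finset ι := {a | 0 < cross (g i) (g a)} with hs
  let c : ι → ℕ := fun a => #{b | 0 < cross (g a) (g b) ∧ 0 < cross (g b) (g i)}
  have hp := dot_self_pos hi
  have hsum : cyclicCount g i = ∑ a ∈ s, c a := by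
    have : ({p : ι × ι | Cyclic g i p.1 p.2} : Finset (ι × ι)) =
        s.biUnion fun a => ({b | 0 < cross (g a) (g b) ∧ 0 < cross (g b) (g i)} : Finset ι).map
          ⟨fun b => (a, b), fun _ _ h => (Prod.ext_iff.1 h).2⟩ := by
      ext ⟨a, b⟩
      simp only [hs, Finset.mem_filter, Finset.mem_univ, true_and, Finset.mem_biUnion,
        Finset.mem_map]
      constructor
      · rintro ⟨h1, h2, h3⟩
        exact ⟨a, h1, b, ⟨h2, h3⟩, rfl⟩
      · rintro ⟨a, h1, b, ⟨h2, h3⟩, ⟨⟩⟩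
        exact ⟨h1, h2, h3⟩
    rw [cyclicCount, this, Finset.card_biUnion]
    · simp [c]
    · intro a _ a' _ hne
      simp only [Function.onFun]
      rw [Finset.disjoint_left]
      simp only [Finset.mem_map, Finset.mem_filter, Finset.mem_univ, true_and]
      rintro _ ⟨b, _, rfl⟩ ⟨b', _, h⟩
      exact hne (Prod.ext_iff.1 h).1.symm
  rw [hsum]
  refine sum_ge_of_three_le_card s (fun a => dot (g i) (g a) / cross (g i) (g a)) c _
    (hg _ hi) fun a ha => ?_
  have ha' : 0 < cross (g i) (g a) := by simpa [hs] using ha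
  have ha0 : g a ≠ 0 := by
    intro h; simp [h, cross] at ha'
  have h3 := hg _ ha0
  let A : Finset ι := {b | 0 < cross (g a) (g b) ∧ 0 < cross (g b) (g i)}
  let B : Finset ι :=
    {b ∈ s | dot (g i) (g b) / cross (g i) (g b) < dot (g i) (g a) / cross (g i) (g a)}
  let O : Finset ι := {j | Antipodal g i j}
  have hsub : ({j | 0 < cross (g a) (g j)} : Finset ι) ⊆ A ∪ B ∪ O := by
    intro j hj
    simp only [hs, A, B, O, Finset.mem_filter, Finset.mem_univ, true_and, Finset.mem_union] at hj ⊢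
    have key := dot_self_mul_cross (g i) (g a) (g j)
    have hpos := mul_pos hp hj
    rcases lt_trichotomy (cross (g i) (g j)) 0 with h | h | h
    · refine Or.inl (Or.inl ⟨hj, ?_⟩)
      rw [cross_swap]; linarith
    · refine Or.inr ⟨h, ?_⟩
      rw [h] at key
      by_contra! hd
      nlinarith
    · refine Or.inl (Or.inr ⟨h, ?_⟩)
      rw [div_lt_div_iff₀ h ha']
      linarith
  have h4 := Finset.card_le_card hsub
  have h5 := Finset.card_union_le (A ∪ B) O
  have h6 := Finset.card_union_le A B
  change _ ≤ #A + #B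
  change 3 - #O ≤ _
  omega

lemma ThreeBalanced.weight_ge {g : ι → ℝ × ℝ} (hg : ThreeBalanced g) {i : ι} (hi : g i ≠ 0) :
    8 ≤ 2 * cyclicCount g i + 3 * antipodalCount g i ∧
      (antipodalCount g i ≠ 2 → 9 ≤ 2 * cyclicCount g i + 3 * antipodalCount g i) := by
  have := hg.cyclicCount_ge hi
  omega

/-- A set of vectors on the line through a given vector, disjoint from the antipodes, bounds the
number of nonzero vectors from below. -/
lemma ThreeBalanced.card_add_le {g : ι → ℝ × ℝ} (hg : ThreeBalanced g) {i : ι} (hi : g i ≠ 0)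
    (s : Finset ι) (hs : ∀ k ∈ s, cross (g i) (g k) = 0 ∧ 0 < dot (g i) (g k)) :
    6 + antipodalCount g i + #s ≤ #{k | g k ≠ 0} := by
  classical
  have hP := hg _ hi
  have hN := hg.card_neg hi
  let A : Finset ι := {j | 0 < cross (g i) (g j)}
  let B : Finset ι := {j | cross (g i) (g j) < 0}
  let O : Finset ι := {j | Antipodal g i j}
  let Z : Finset ι := {k | g k ≠ 0}
  have d1 : Disjoint A B := by
    simp only [A, B, Finset.disjoint_filter]
    intro j _ h; exact not_lt.2 h.le
  have d2 : Disjoint (A ∪ B) O := by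
    rw [Finset.disjoint_left]
    intro j hj hj'
    simp only [A, B, O, Finset.mem_union, Finset.mem_filter, Finset.mem_univ, true_and] at hj hj'
    rw [hj'.1] at hj
    simp at hj
  have d3 : Disjoint (A ∪ B ∪ O) s := by
    rw [Finset.disjoint_left]
    intro j hj hj'
    obtain ⟨h1, h2⟩ := hs j hj'
    simp only [A, B, O, Finset.mem_union, Finset.mem_filter, Finset.mem_univ, true_and, h1, lt_irrefl, false_or] at hj
    exact absurd hj.2 (not_lt.2 h2.le)
  have hsub : (A ∪ B ∪ O) ∪ s ⊆ Z := by
    intro j hj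
    simp only [A, B, O, Z, Finset.mem_union, Finset.mem_filter, Finset.mem_univ, true_and] at hj ⊢
    intro h0
    rcases hj with ((h | h) | h) | h
    · simp [h0, cross] at h
    · simp [h0, cross] at h
    · have := h.2
      simp [h0, dot] at this
    · have := (hs j h).2
      simp [h0, dot] at this
  have := Finset.card_le_card hsub
  rw [Finset.card_union_of_disjoint d3, Finset.card_union_of_disjoint d2, Finset.card_union_of_disjoint d1] at this
  change 6 + #O + #s ≤ #Z
  change 3 ≤ #A at hP
  change 3 ≤ #B at hN
  omega

lemma ThreeBalanced.weight_sum_ge {g : ι → ℝ × ℝ} (hg : ThreeBalanced g) {i₀ : ι}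
    (h₀ : g i₀ ≠ 0) :
    6 * #{k | g k ≠ 0} + 19 ≤ ∑ i, (2 * cyclicCount g i + 3 * antipodalCount g i) := by
  classical
  set s : Finset ι := {k | g k ≠ 0} with hs
  have hmem : ∀ i ∈ s, g i ≠ 0 := fun i hi => by simpa [hs] using hi
  refine le_trans ?_ (Finset.sum_le_sum_of_subset (Finset.subset_univ s))
  have hself : ∀ i ∈ s, 7 + antipodalCount g i ≤ #s := by
    intro i hi
    have := hg.card_add_le (hmem i hi) {i} (by
      intro k hk
      rw [Finset.mem_singleton] at hk
      subst hk
      exact ⟨cross_self_eq_zero _, dot_self_pos (hmem _ hi)⟩)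
    rw [Finset.card_singleton] at this
    change 6 + antipodalCount g i + 1 ≤ #s at this
    omega
  have h7 := hself i₀ (by simpa [hs] using h₀)
  by_cases h2 : ∃ i ∈ s, antipodalCount g i = 2
  · obtain ⟨i, hi, hoi⟩ := h2
    have hi0 := hmem i hi
    have h9 := hself i hi
    obtain ⟨j, hj⟩ : ({j | Antipodal g i j} : Finset ι).Nonempty :=
      Finset.card_pos.1 (by unfold antipodalCount at hoi; omega)
    have hij : Antipodal g i j := by simpa using hj
    have hj0 : g j ≠ 0 := by
      intro h
      have := hij.2
      simp [h, dot] at this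
    have hjs : j ∈ s := by simpa [hs] using hj0
    have hoj := hg.card_add_le hi0 {k | Antipodal g j k} (by
      intro k hk
      have hk : Antipodal g j k := by simpa using hk
      have hp := dot_self_pos hj0
      have e1 := dot_self_mul_cross (g j) (g i) (g k)
      have e2 := dot_self_mul_dot (g j) (g i) (g k)
      rw [hij.symm.1, hk.1] at e1 e2
      have := mul_pos_of_neg_of_neg hij.symm.2 hk.2
      constructor
      · have : dot (g j) (g j) * cross (g i) (g k) = 0 := by rw [e1]; ring
        exact (mul_eq_zero.1 this).resolve_left hp.ne'
      · by_contra! hd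
        nlinarith)
    change 6 + antipodalCount g i + antipodalCount g j ≤ #s at hoj
    have hrest : #(s.erase j) * 8 ≤
        ∑ i ∈ s.erase j, (2 * cyclicCount g i + 3 * antipodalCount g i) := by
      rw [← smul_eq_mul]
      exact Finset.card_nsmul_le_sum _ _ _ fun k hk => (hg.weight_ge (hmem k (Finset.mem_of_mem_erase hk))).1
    rw [Finset.card_erase_of_mem hjs] at hrest
    rw [← Finset.add_sum_erase s _ hjs]
    have := hg.weight_ge hj0
    by_cases hm : #s = 9
    · have := this.2 (by omega)
      omega
    · have := this.1
      omega
  · push Not at h2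
    have : #s * 9 ≤ ∑ i ∈ s, (2 * cyclicCount g i + 3 * antipodalCount g i) := by
      rw [← smul_eq_mul]
      exact Finset.card_nsmul_le_sum _ _ _ fun k hk => (hg.weight_ge (hmem k hk)).2 (h2 k hk)
    omega

/-- A three-balanced configuration has at least four more positive circuits than vectors. -/
theorem ThreeBalanced.exists_circuits {g : ι → ℝ × ℝ} (hg : ThreeBalanced g) :
    ∃ 𝒞 : Finset (Finset ι), Fintype.card ι + 4 ≤ #𝒞 ∧
      ∀ C ∈ 𝒞, IsPosCircuit g C ∧ C.Nonempty ∧ #C ≤ 3 := by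
  classical
  let X₁ : Finset ι := {i | g i = 0}
  let X₂ : Finset (ι × ι) := {p | Antipodal g p.1 p.2}
  let X₃ : Finset (ι × ι × ι) := {p | Cyclic g p.1 p.2.1 p.2.2}
  let 𝒞₁ := X₁.image fun i => ({i} : Finset ι)
  let 𝒞₂ := X₂.image fun p => ({p.1, p.2} : Finset ι)
  let 𝒞₃ := X₃.image fun p => ({p.1, p.2.1, p.2.2} : Finset ι)
  have k₁ : ∀ C ∈ 𝒞₁, #C = 1 ∧ IsPosCircuit g C := by
    simp only [𝒞₁, X₁, Finset.mem_image, Finset.mem_filter, Finset.mem_univ, true_and]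
    rintro _ ⟨i, hi, rfl⟩
    exact ⟨Finset.card_singleton _, isPosCircuit_singleton hi⟩
  have k₂ : ∀ C ∈ 𝒞₂, #C = 2 ∧ IsPosCircuit g C := by
    simp only [𝒞₂, X₂, Finset.mem_image, Finset.mem_filter, Finset.mem_univ, true_and]
    rintro _ ⟨⟨i, j⟩, hij, rfl⟩
    refine ⟨Finset.card_pair ?_, isPosCircuit_pair hij⟩
    rintro (rfl : i = j)
    exact absurd hij.2 (not_lt.2 (dot_self_nonneg _))
  have k₃ : ∀ C ∈ 𝒞₃, #C = 3 ∧ IsPosCircuit g C := by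
    simp only [𝒞₃, X₃, Finset.mem_image, Finset.mem_filter, Finset.mem_univ, true_and]
    rintro _ ⟨⟨i, a, b⟩, h, rfl⟩
    obtain ⟨h1, h2, h3⟩ := Cyclic.ne h
    exact ⟨Finset.card_eq_three.2 ⟨i, a, b, h1, h3.symm, h2, rfl⟩, isPosCircuit_triple h⟩
  have c₁ : #𝒞₁ = #X₁ := Finset.card_image_of_injective _ Finset.singleton_injective
  have c₂ : #X₂ ≤ 2 * #𝒞₂ := by
    refine Finset.card_le_mul_card_image _ _ fun C hC => ?_
    rw [← (k₂ C hC).1]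
    refine Finset.card_le_card_of_injOn Prod.fst ?_ ?_
    · rintro ⟨i, j⟩ h
      simp only [Finset.coe_filter, Set.mem_ofPred_eq] at h
      rw [← h.2]
      simp
    · rintro ⟨i, j⟩ h ⟨i', j'⟩ h' (rfl : i = i')
      simp only [Finset.coe_filter, Set.mem_ofPred_eq, X₂, Finset.mem_filter, Finset.mem_univ, true_and] at h h'
      have hj : j ∈ ({i, j'} : Finset ι) := by rw [h'.2, ← h.2]; simp
      simp only [Finset.mem_insert, Finset.mem_singleton] at hj
      rcases hj with rfl | rfl
      · exact absurd h.1.2 (not_lt.2 (dot_self_nonneg _))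
      · rfl
  have c₃ : #X₃ ≤ 3 * #𝒞₃ := by
    refine Finset.card_le_mul_card_image _ _ fun C hC => ?_
    rw [← (k₃ C hC).1]
    refine Finset.card_le_card_of_injOn Prod.fst ?_ ?_
    · rintro ⟨i, a, b⟩ h
      simp only [Finset.coe_filter, Set.mem_ofPred_eq] at h
      rw [← h.2]
      simp
    · rintro ⟨i, a, b⟩ h ⟨i', a', b'⟩ h' (rfl : i = i')
      simp only [Finset.coe_filter, Set.mem_ofPred_eq, X₃, Finset.mem_filter, Finset.mem_univ, true_and] at h h'
      obtain ⟨hc, hC⟩ := h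
      obtain ⟨hc', hC'⟩ := h'
      obtain ⟨n1, n2, n3⟩ := hc.ne
      have ha : a ∈ ({i, a', b'} : Finset ι) := by rw [hC', ← hC]; simp
      have hb : b ∈ ({i, a', b'} : Finset ι) := by rw [hC', ← hC]; simp
      simp only [Finset.mem_insert, Finset.mem_singleton, n1.symm, n3, false_or] at ha hb
      rcases ha with rfl | rfl
      · rcases hb with rfl | rfl
        · exact absurd rfl n2
        · rfl
      · have e1 := hc.1
        have e2 := hc'.2.2
        rw [cross_swap] at e2
        linarith
  have s₂ : ∑ i, antipodalCount g i = #X₂ := by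
    simp only [X₂, antipodalCount, Finset.card_filter, ← Finset.univ_product_univ, Finset.sum_product]
  have s₃ : ∑ i, cyclicCount g i = #X₃ := by
    simp only [X₃, cyclicCount, Finset.card_filter, ← Finset.univ_product_univ, Finset.sum_product]
  have hX : #X₁ + #{k | g k ≠ 0} = Fintype.card ι := Finset.card_filter_add_card_filter_not _
  obtain ⟨i₀, h₀⟩ : ∃ i, g i ≠ 0 := by
    by_contra! h
    have := hg (1, 0) (by simp)
    simp [h, cross] at this
  have hw := hg.weight_sum_ge h₀
  rw [Finset.sum_add_distrib, ← Finset.mul_sum, ← Finset.mul_sum, s₂, s₃] at hw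
  have d12 : Disjoint 𝒞₁ 𝒞₂ := Finset.disjoint_left.2 fun C h h' => by
    have := (k₁ C h).1
    have := (k₂ C h').1
    omega
  have d123 : Disjoint (𝒞₁ ∪ 𝒞₂) 𝒞₃ := Finset.disjoint_left.2 fun C h h' => by
    have h3 := (k₃ C h').1
    rcases Finset.mem_union.1 h with h | h
    · have := (k₁ C h).1
      omega
    · have := (k₂ C h).1
      omega
  refine ⟨(𝒞₁ ∪ 𝒞₂) ∪ 𝒞₃, ?_, ?_⟩
  · rw [Finset.card_union_of_disjoint d123, Finset.card_union_of_disjoint d12]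
    omega
  · intro C hC
    rcases Finset.mem_union.1 hC with hC | hC
    · rcases Finset.mem_union.1 hC with hC | hC
      · exact ⟨(k₁ C hC).2, Finset.card_pos.1 (by rw [(k₁ C hC).1]; omega), (k₁ C hC).1.le.trans (by omega)⟩
      · exact ⟨(k₂ C hC).2, Finset.card_pos.1 (by rw [(k₂ C hC).1]; omega), (k₂ C hC).1.le.trans (by omega)⟩
    · exact ⟨(k₃ C hC).2, Finset.card_pos.1 (by rw [(k₃ C hC).1]; omega), (k₃ C hC).1.le⟩

end PlanarConfigurations

section LinearRelations

variable {M : Type*} [AddCommGroup M] [Module ℝ M]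

lemma finrank_inf_ker_add_one [FiniteDimensional ℝ M] (U : Submodule ℝ M) (m : M →ₗ[ℝ] ℝ) {x : M}
    (hx : x ∈ U) (hm : m x ≠ 0) :
    Module.finrank ℝ ↥(U ⊓ LinearMap.ker m) + 1 = Module.finrank ℝ U := by
  have h := LinearMap.finrank_range_add_finrank_ker (m.comp U.subtype)
  have hr : LinearMap.range (m.comp U.subtype) = ⊤ := by
    rw [LinearMap.range_eq_top]
    apply LinearMap.surjective
    intro h0
    exact hm (by simpa using LinearMap.congr_fun h0 ⟨x, hx⟩)
  rw [hr, finrank_top, Module.finrank_self, LinearMap.ker_comp,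
    ← Submodule.finrank_map_subtype_eq, Submodule.map_comap_subtype] at h
  omega

/-- The linear span of the homogenization of a nonempty set. -/
lemma finrank_span_homogenization [FiniteDimensional ℝ M] {s : Set M} (hs : s.Nonempty) :
    Module.finrank ℝ (Submodule.span ℝ ((fun x => ((1 : ℝ), x)) '' s)) =
      Module.finrank ℝ (affineSpan ℝ s).direction + 1 := by
  obtain ⟨x₀, h₀⟩ := hs
  set U := Submodule.span ℝ ((fun x : M => ((1 : ℝ), x)) '' s) with hU
  have hlift : ∀ x ∈ s, ((1 : ℝ), x) ∈ U := fun x hx => Submodule.subset_span ⟨x, hx, rfl⟩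
  rw [← finrank_inf_ker_add_one U (LinearMap.fst ℝ ℝ M) (hlift x₀ h₀) (by simp),
    direction_affineSpan]
  have hker : U ⊓ LinearMap.ker (LinearMap.fst ℝ ℝ M) =
      (vectorSpan ℝ s).map (LinearMap.inr ℝ ℝ M) := by
    apply le_antisymm
    · rintro ⟨t, x⟩ ⟨hx, ht⟩
      have ht : t = 0 := by simpa using ht
      subst ht
      have hle : U ≤ (vectorSpan ℝ s).comap
          (LinearMap.snd ℝ ℝ M - (LinearMap.fst ℝ ℝ M).smulRight x₀) := by
        rw [hU, Submodule.span_le]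
        rintro _ ⟨y, hy, rfl⟩
        simpa using vsub_mem_vectorSpan ℝ hy h₀
      exact ⟨x, by simpa using hle hx, rfl⟩
    · rw [Submodule.map_le_iff_le_comap, vectorSpan, Submodule.span_le]
      rintro _ ⟨x, hx, y, hy, rfl⟩
      have := U.sub_mem (hlift x hx) (hlift y hy)
      simpa using this
  rw [hker, ← (Submodule.equivMapOfInjective (LinearMap.inr ℝ ℝ M) LinearMap.inr_injective
    (vectorSpan ℝ s)).finrank_eq]

variable {ι : Type*} [Fintype ι]

/-- Vectors whose linear relations form a plane have a planar Gale transform. -/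
lemma exists_planar_gale_transform [FiniteDimensional ℝ M] (w : ι → M)
    (hw : Module.finrank ℝ (Submodule.span ℝ (Set.range w)) + 2 = Fintype.card ι) :
    ∃ g : ι → ℝ × ℝ,
      (∀ u : ι → ℝ, ∑ i, u i • g i = 0 ↔ ∃ m : M →ₗ[ℝ] ℝ, ∀ i, u i = m (w i)) ∧
      ∀ q : ℝ × ℝ, q ≠ 0 → (∃ i, cross q (g i) ≠ 0) ∧ ∑ i, cross q (g i) • w i = 0 := by
  classical
  set Φ := Fintype.linearCombination ℝ w with hΦ
  have hrank := LinearMap.finrank_range_add_finrank_ker Φ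
  rw [Fintype.range_linearCombination, Module.finrank_fintype_fun_eq_card] at hrank
  let b := Module.finBasisOfFinrankEq ℝ (LinearMap.ker Φ) (n := 2) (by omega)
  have hb : ∀ k, ∑ i, (b k : ι → ℝ) i • w i = 0 := fun k => by
    have : Φ (b k : ι → ℝ) = 0 := (b k).2
    rwa [← Fintype.linearCombination_apply]
  refine ⟨fun i => ((b 0 : ι → ℝ) i, (b 1 : ι → ℝ) i), fun u => ?_, fun q hq => ⟨?_, ?_⟩⟩
  · have hu : ∑ i, u i • (((b 0 : ι → ℝ) i, (b 1 : ι → ℝ) i) : ℝ × ℝ) = 0 ↔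
        ∀ k, ∑ i, u i * (b k : ι → ℝ) i = 0 := by
      simp [Prod.ext_iff, Fin.forall_fin_two, Prod.fst_sum, Prod.snd_sum]
    rw [hu]
    constructor
    · intro h
      let ℓ : Module.Dual ℝ (ι → ℝ) := Fintype.linearCombination ℝ u
      have hℓ : ℓ ∈ LinearMap.range Φ.dualMap := by
        rw [LinearMap.range_dualMap_eq_dualAnnihilator_ker, Submodule.mem_dualAnnihilator]
        intro c hc
        have hc' := congrArg Subtype.val (b.sum_repr ⟨c, hc⟩)
        rw [Fin.sum_univ_two] at hc'
        simp only [Submodule.coe_add, Submodule.coe_smul] at hc'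
        have hk : ∀ k, ℓ (b k : ι → ℝ) = 0 := fun k => by
          rw [← h k]
          simp [ℓ, Fintype.linearCombination_apply, mul_comm]
        rw [← hc', map_add, map_smul, map_smul, hk, hk, smul_zero, smul_zero, add_zero]
      obtain ⟨m, hm⟩ := hℓ
      refine ⟨m, fun i => ?_⟩
      have := LinearMap.congr_fun hm (Pi.single i 1)
      simpa [ℓ, hΦ] using this.symm
    · rintro ⟨m, hm⟩ k
      have := congrArg m (hb k)
      simpa [hm, map_sum, mul_comm] using this
  · by_contra! h
    have hli := b.linearIndependent
    rw [Fintype.linearIndependent_iff] at hli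
    have := hli ![-q.2, q.1] (by
      ext i
      have := h i
      simp only [cross] at this
      simp only [Fin.sum_univ_two, Matrix.cons_val_zero, Matrix.cons_val_one, Submodule.coe_add,
        Submodule.coe_smul, Pi.add_apply, Pi.smul_apply, smul_eq_mul, Submodule.coe_zero,
        Pi.zero_apply]
      linarith)
    have h0 := this 0
    have h1 := this 1
    simp only [Matrix.cons_val_zero, Matrix.cons_val_one, neg_eq_zero] at h0 h1
    exact hq (Prod.ext h1 h0)
  · have h0 := hb 0
    have h1 := hb 1
    calc _ = q.1 • ∑ i, (b 1 : ι → ℝ) i • w i - q.2 • ∑ i, (b 0 : ι → ℝ) i • w i := by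
          simp only [cross, sub_smul, mul_smul, Finset.sum_sub_distrib, Finset.smul_sum]
      _ = 0 := by rw [h0, h1, smul_zero, smul_zero, sub_zero]

/-- If any two of the vectors are the zero set of a nonnegative functional, then every
nontrivial relation has three positive coefficients. -/
lemma three_le_card_pos_of_relation (w : ι → M)
    (hsep : ∀ i j, i ≠ j → ∃ m : M →ₗ[ℝ] ℝ, m (w i) = 0 ∧ m (w j) = 0 ∧
      ∀ k, k ≠ i → k ≠ j → 0 < m (w k))
    (hind : ∀ i j, i ≠ j → ∀ a b : ℝ, a • w i + b • w j = 0 → a = 0 ∧ b = 0)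
    (hcard : 2 ≤ Fintype.card ι) (c : ι → ℝ) (hc : ∑ i, c i • w i = 0) (hne : ∃ i, c i ≠ 0) :
    3 ≤ (Finset.univ.filter fun i => 0 < c i).card := by
  classical
  by_contra! hlt
  obtain ⟨T, hT, hT2⟩ := Finset.exists_superset_card_eq (Nat.le_of_lt_succ hlt) hcard
  obtain ⟨i, j, hij, rfl⟩ := Finset.card_eq_two.1 hT2
  obtain ⟨m, hi, hj, hk⟩ := hsep i j hij
  have hneg : ∀ k, k ≠ i → k ≠ j → c k ≤ 0 := by
    intro k hki hkj
    by_contra! hpos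
    have := hT (Finset.mem_filter.2 ⟨Finset.mem_univ k, hpos⟩)
    simp [hki, hkj] at this
  have hsum : ∑ k, c k * m (w k) = 0 := by
    have := congrArg m hc
    simpa using this
  have hterm : ∀ k ∈ Finset.univ, c k * m (w k) ≤ 0 := by
    intro k _
    by_cases hki : k = i
    · simp [hki, hi]
    by_cases hkj : k = j
    · simp [hkj, hj]
    exact mul_nonpos_of_nonpos_of_nonneg (hneg k hki hkj) (hk k hki hkj).le
  rw [Finset.sum_eq_zero_iff_of_nonpos hterm] at hsum
  have hzero : ∀ k, k ≠ i → k ≠ j → c k = 0 := fun k hki hkj =>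
    (mul_eq_zero.1 (hsum k (Finset.mem_univ k))).resolve_right (hk k hki hkj).ne'
  rw [← Finset.sum_subset (Finset.subset_univ {i, j}) (fun k _ hk => by
    simp only [Finset.mem_insert, Finset.mem_singleton, not_or] at hk
    rw [hzero k hk.1 hk.2, zero_smul]), Finset.sum_pair hij] at hc
  obtain ⟨h1, h2⟩ := hind i j hij _ _ hc
  obtain ⟨k, hk⟩ := hne
  by_cases hki : k = i
  · exact hk (hki ▸ h1)
  by_cases hkj : k = j
  · exact hk (hkj ▸ h2)
  exact hk (hzero k hki hkj)

end LinearRelations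

section Polytopes

variable {N : ℕ} {P F : Set (Fin N → ℝ)}

lemma vertexSet_subset_extremePoints : vertexSet P ⊆ P.extremePoints ℝ := fun _ hv =>
  isExtreme_singleton.1 (IsExposed.isExtreme hv)

lemma IsPolytope.convex (hP : IsPolytope P) : Convex ℝ P := by
  obtain ⟨S, rfl⟩ := hP
  exact convex_convexHull ℝ _

lemma IsPolytope.isCompact (hP : IsPolytope P) : IsCompact P := by
  obtain ⟨S, rfl⟩ := hP
  exact S.finite_toSet.isCompact_convexHull ℝ

lemma IsPolytope.vertexSet_eq (hP : IsPolytope P) : vertexSet P = P.extremePoints ℝ := by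
  obtain ⟨S, rfl⟩ := hP
  refine subset_antisymm vertexSet_subset_extremePoints fun v hv => ?_
  have hvS : v ∈ (S : Set (Fin N → ℝ)) := extremePoints_convexHull_subset hv
  have hnot : v ∉ convexHull ℝ ((S : Set (Fin N → ℝ)) \ {v}) := fun h => by
    have := inter_extremePoints_subset_extremePoints_of_subset
      (convexHull_mono (𝕜 := ℝ) (sdiff_subset (s := (S : Set (Fin N → ℝ))) (t := {v}))) ⟨h, hv⟩
    exact (extremePoints_convexHull_subset this).2 rfl
  obtain ⟨l, t, hlt, htl⟩ := geometric_hahn_banach_closed_point (convex_convexHull ℝ _)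
    ((S.finite_toSet.subset sdiff_subset).isClosed_convexHull ℝ) hnot
  have hle : ∀ y ∈ convexHull ℝ (S : Set (Fin N → ℝ)), l y ≤ l v := by
    refine fun y hy => convexHull_min (t := {y | l y ≤ l v}) (fun s hs => ?_)
      (convex_halfSpace_le l.isLinear _) hy
    by_cases hsv : s = v
    · simp [hsv]
    · exact ((hlt s (subset_convexHull ℝ _ ⟨hs, hsv⟩)).trans htl).le
  set P := convexHull ℝ (S : Set (Fin N → ℝ)) with hP
  have hG : IsExposed ℝ P (l.toExposed P) := ContinuousLinearMap.toExposed.isExposed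
  have hvG : v ∈ l.toExposed P := ⟨hv.1, hle⟩
  have hGv : l.toExposed P ⊆ {v} := by
    rw [← closure_convexHull_extremePoints (hG.isCompact (S.finite_toSet.isCompact_convexHull ℝ))
      (hG.convex (convex_convexHull ℝ _)), hG.isExtreme.extremePoints_eq]
    refine closure_minimal (convexHull_min ?_ (convex_singleton v)) isClosed_singleton
    rintro x ⟨hxG, hx⟩
    by_contra hxv
    have hxl := hlt x (subset_convexHull ℝ _ ⟨extremePoints_convexHull_subset hx, hxv⟩)
    exact absurd (hxG.2 v hv.1) (not_le.2 (hxl.trans htl))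
  rwa [subset_antisymm hGv (singleton_subset_iff.2 hvG)] at hG

lemma IsPolytope.finite_vertexSet (hP : IsPolytope P) : (vertexSet P).Finite := by
  rw [hP.vertexSet_eq]
  obtain ⟨S, rfl⟩ := hP
  exact S.finite_toSet.subset extremePoints_convexHull_subset

lemma IsPolytope.convexHull_inter_vertexSet (hP : IsPolytope P) (hF : IsExposed ℝ P F) :
    convexHull ℝ (F ∩ vertexSet P) = F := by
  have h := closure_convexHull_extremePoints (hF.isCompact hP.isCompact) (hF.convex hP.convex)
  rw [hF.isExtreme.extremePoints_eq, ← hP.vertexSet_eq] at h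
  rwa [((hP.finite_vertexSet.subset inter_subset_right).isClosed_convexHull ℝ).closure_eq] at h

lemma IsPolytope.convexHull_vertexSet (hP : IsPolytope P) : convexHull ℝ (vertexSet P) = P := by
  have h := hP.convexHull_inter_vertexSet (IsExposed.refl (𝕜 := ℝ) P)
  rwa [inter_eq_right.2 fun v hv => (vertexSet_subset_extremePoints hv).1] at h

lemma IsPolytope.finite_facetSet (hP : IsPolytope P) : (facetSet P).Finite :=
  (hP.finite_vertexSet.finite_subsets.image fun A => convexHull ℝ A).subset fun F hF =>
    ⟨F ∩ vertexSet P, inter_subset_right, hP.convexHull_inter_vertexSet hF.1⟩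

/-- Pairs of vertices of a 2-neighborly polytope are cut out by supporting functionals. -/
lemma TwoNeighborly.exists_functional (hnb : TwoNeighborly P) {u v : Fin N → ℝ}
    (hu : u ∈ vertexSet P) (hv : v ∈ vertexSet P) (huv : u ≠ v) :
    ∃ m : ℝ × (Fin N → ℝ) →ₗ[ℝ] ℝ, m (1, u) = 0 ∧ m (1, v) = 0 ∧
      ∀ k ∈ vertexSet P, k ≠ u → k ≠ v → 0 < m (1, k) := by
  have hE := (hnb u v hu hv huv).1
  have huE : u ∈ convexHull ℝ {u, v} := subset_convexHull ℝ _ (by simp)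
  have hvE : v ∈ convexHull ℝ {u, v} := subset_convexHull ℝ _ (by simp)
  obtain ⟨l, hl⟩ := hE ⟨u, huE⟩
  have hu' := huE
  have hv' := hvE
  rw [hl] at hu' hv'
  refine ⟨(LinearMap.fst ℝ ℝ _).smulRight (l u) - (l : (Fin N → ℝ) →ₗ[ℝ] ℝ).comp
    (LinearMap.snd ℝ ℝ _), by simp, ?_, fun k hk hku hkv => ?_⟩
  · simpa [sub_eq_zero] using le_antisymm (hv'.2 u hu'.1) (hu'.2 v hv'.1)
  · have hkx := vertexSet_subset_extremePoints hk
    have hle := hu'.2 k hkx.1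
    have hne : l k ≠ l u := by
      intro he
      have hkE : k ∈ convexHull ℝ {u, v} := by
        rw [hl]
        exact ⟨hkx.1, fun y hy => he ▸ hu'.2 y hy⟩
      have := extremePoints_convexHull_subset
        (inter_extremePoints_subset_extremePoints_of_subset hE.subset ⟨hkE, hkx⟩)
      simp [hku, hkv] at this
    have := lt_of_le_of_ne hle hne
    simpa using this

/-- A functional that is nonnegative on a polytope and determined up to scaling by the vertices
where it vanishes cuts out a facet. -/
lemma IsPolytope.isFacetOf_of_functional (hP : IsPolytope P) (m : ℝ × (Fin N → ℝ) →ₗ[ℝ] ℝ)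
    (hm : ∀ x ∈ vertexSet P, 0 ≤ m (1, x)) (hzero : ∃ x ∈ vertexSet P, m (1, x) = 0)
    (hpos : ∃ x ∈ vertexSet P, m (1, x) ≠ 0)
    (huniq : ∀ m' : ℝ × (Fin N → ℝ) →ₗ[ℝ] ℝ,
      (∀ x ∈ vertexSet P, m (1, x) = 0 → m' (1, x) = 0) →
        ∃ t : ℝ, ∀ x ∈ vertexSet P, m' (1, x) = t * m (1, x)) :
    IsFacetOf P {x ∈ P | m (1, x) = 0} := by
  set F : Set (Fin N → ℝ) := {x ∈ P | m (1, x) = 0} with hF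
  obtain ⟨x₀, h₀, hx₀⟩ := hzero
  obtain ⟨x₁, h₁, hx₁⟩ := hpos
  have hVP : vertexSet P ⊆ P := fun v hv => (vertexSet_subset_extremePoints hv).1
  have hsplit : ∀ x, m (1, x) = m (1, 0) + m (0, x) := fun x => by
    rw [← map_add]; simp
  have hnonneg : ∀ x ∈ P, 0 ≤ m (1, x) := by
    intro x hx
    rw [← hP.convexHull_vertexSet] at hx
    have hconv : Convex ℝ {x : Fin N → ℝ | 0 ≤ m (1, x)} := by
      have e : {x : Fin N → ℝ | 0 ≤ m (1, x)} =
          {x | -m (1, 0) ≤ (m.comp (LinearMap.inr ℝ ℝ (Fin N → ℝ))) x} := by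
        ext x
        change 0 ≤ m (1, x) ↔ -m (1, 0) ≤ m (0, x)
        rw [hsplit x, neg_le_iff_add_nonneg']
      rw [e]
      exact convex_halfSpace_ge (m.comp (LinearMap.inr ℝ ℝ (Fin N → ℝ))).isLinear (-m (1, 0))
    exact convexHull_min hm hconv hx
  have hexp : IsExposed ℝ P F := by
    intro _
    refine ⟨-LinearMap.toContinuousLinearMap (m.comp (LinearMap.inr ℝ ℝ (Fin N → ℝ))), ?_⟩
    ext x
    have e : ∀ x, (-LinearMap.toContinuousLinearMap (m.comp (LinearMap.inr ℝ ℝ (Fin N → ℝ)))) x =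
        m (1, 0) - m (1, x) := fun x => by rw [hsplit x]; simp
    simp only [hF, mem_sep_iff, e]
    refine and_congr_right fun hx => ⟨fun h y hy => ?_, fun h => ?_⟩
    · have := hnonneg y hy
      linarith
    · have := h x₀ (hVP h₀)
      have := hnonneg x hx
      linarith
  have hx₀F : x₀ ∈ F ∩ vertexSet P := ⟨⟨hVP h₀, hx₀⟩, h₀⟩
  refine ⟨hexp, ⟨x₀, hx₀F.1⟩, ?_⟩
  have hdP : Module.finrank ℝ (Submodule.span ℝ ((fun x => ((1 : ℝ), x)) '' vertexSet P)) =
      pdim P + 1 := by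
    rw [finrank_span_homogenization ⟨x₀, h₀⟩, pdim, ← affineSpan_convexHull,
      hP.convexHull_vertexSet]
  have hdF : Module.finrank ℝ (Submodule.span ℝ ((fun x => ((1 : ℝ), x)) '' (F ∩ vertexSet P))) =
      pdim F + 1 := by
    rw [finrank_span_homogenization ⟨x₀, hx₀F⟩, pdim, ← affineSpan_convexHull (F ∩ vertexSet P),
      hP.convexHull_inter_vertexSet hexp]
  set U := Submodule.span ℝ ((fun x => ((1 : ℝ), x)) '' vertexSet P) with hU
  have hlift : ∀ x ∈ vertexSet P, ((1 : ℝ), x) ∈ U := fun x hx =>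
    Submodule.subset_span ⟨x, hx, rfl⟩
  have hinf : U ⊓ LinearMap.ker m =
      Submodule.span ℝ ((fun x => ((1 : ℝ), x)) '' (F ∩ vertexSet P)) := by
    apply le_antisymm
    · rintro p ⟨hpU, hpm⟩
      by_contra hp
      obtain ⟨m', hm'p, hm'⟩ := Submodule.exists_le_ker_of_notMem hp
      obtain ⟨t, ht⟩ := huniq m' fun x hx hx0 =>
        hm' (Submodule.subset_span ⟨x, ⟨⟨hVP hx, hx0⟩, hx⟩, rfl⟩)
      have hle : U ≤ LinearMap.ker (m' - t • m) := by
        rw [hU, Submodule.span_le]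
        rintro _ ⟨x, hx, rfl⟩
        simp [ht x hx]
      have hpm : m p = 0 := hpm
      have := hle hpU
      exact hm'p (by simpa [hpm] using this)
    · rw [Submodule.span_le]
      rintro _ ⟨x, hx, rfl⟩
      exact ⟨hlift x hx.2, hx.1.2⟩
  have := finrank_inf_ker_add_one U m (hlift x₁ h₁) hx₁
  rw [hinf] at this
  omega

end Polytopes

/-- For every integer `d ≥ 4`, every 2-neighborly `d`-polytope with exactly `d + 3`
vertices has at least `d + 7` facets. -/
theorem two_neighborly_d_plus_three_vertices
    (d : ℕ) (hd : 4 ≤ d) {N : ℕ} (P : Set (Fin N → ℝ))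
    (hP : IsPolytope P) (hdim : pdim P = d) (hnb : TwoNeighborly P)
    (hv : (vertexSet P).ncard = d + 3) :
    d + 7 ≤ (facetSet P).ncard := by
  classical
  have hfin := hP.finite_vertexSet
  let _ : Fintype (vertexSet P) := hfin.fintype
  have hcard : Fintype.card (vertexSet P) = d + 3 := by
    rw [← hv, ← Nat.card_coe_set_eq, Nat.card_eq_fintype_card]
  have hne : (vertexSet P).Nonempty := by
    rw [← Set.ncard_pos hfin]
    omega
  let w : vertexSet P → ℝ × (Fin N → ℝ) := fun x => (1, x)
  have hrange : Set.range w = (fun x => ((1 : ℝ), x)) '' vertexSet P := by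
    rw [image_eq_range]
  have hrank : Module.finrank ℝ (Submodule.span ℝ (Set.range w)) + 2 =
      Fintype.card (vertexSet P) := by
    rw [hrange, finrank_span_homogenization hne, hcard, ← affineSpan_convexHull,
      hP.convexHull_vertexSet, ← hdim, pdim]
  obtain ⟨g, hg, hrel⟩ := exists_planar_gale_transform w hrank
  have hbal : ThreeBalanced g := fun q hq =>
    three_le_card_pos_of_relation w
      (fun i j hij => by
        obtain ⟨m, hi, hj, hk⟩ := hnb.exists_functional i.2 j.2 (Subtype.coe_ne_coe.2 hij)
        exact ⟨m, hi, hj, fun k hki hkj =>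
          hk k k.2 (Subtype.coe_ne_coe.2 hki) (Subtype.coe_ne_coe.2 hkj)⟩)
      (fun i j hij a b hab => by
        have h1 := congrArg Prod.fst hab
        have h2 := congrArg Prod.snd hab
        simp only [w, Prod.fst_add, Prod.smul_fst, smul_eq_mul, mul_one, Prod.fst_zero,
          Prod.snd_add, Prod.smul_snd, Prod.snd_zero] at h1 h2
        have hb : b = -a := by linarith
        rw [hb, neg_smul, ← sub_eq_add_neg, ← smul_sub, smul_eq_zero, sub_eq_zero] at h2
        have ha := h2.resolve_right (Subtype.coe_ne_coe.2 hij)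
        exact ⟨ha, by rw [hb, ha, neg_zero]⟩)
      (by omega) _ (hrel q hq).2 (hrel q hq).1
  obtain ⟨𝒞, hlarge, h𝒞⟩ := hbal.exists_circuits
  have hface : ∀ C ∈ 𝒞, ∃ F ∈ facetSet P, ∀ x : vertexSet P, (x : Fin N → ℝ) ∈ F ↔ x ∉ C := by
    intro C hC
    obtain ⟨⟨c, hpos, hzero, hc, huniq⟩, ⟨x₁, hx₁⟩, hC3⟩ := h𝒞 C hC
    obtain ⟨m, hm⟩ := (hg c).1 hc
    obtain ⟨x₀, hx₀⟩ : ∃ x, x ∉ C := by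
      by_contra! h
      have := Finset.card_le_card (fun x _ => h x : Finset.univ ⊆ C)
      rw [Finset.card_univ] at this
      omega
    have hmem : ∀ x : vertexSet P, m (1, (x : Fin N → ℝ)) = 0 ↔ x ∉ C := fun x => by
      change m (w x) = 0 ↔ _
      rw [← hm]
      exact ⟨fun h hx => (hpos x hx).ne' h, hzero x⟩
    refine ⟨{x ∈ P | m (1, x) = 0}, hP.isFacetOf_of_functional m (fun x hx => ?_)
      ⟨x₀, x₀.2, (hmem x₀).2 hx₀⟩ ⟨x₁, x₁.2, fun h => (hmem x₁).1 h hx₁⟩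
      fun m' hm' => ?_, fun x => ?_⟩
    · by_cases hxC : (⟨x, hx⟩ : vertexSet P) ∈ C
      · have := hpos _ hxC
        rw [hm] at this
        exact this.le
      · exact ((hmem ⟨x, hx⟩).2 hxC).ge
    · obtain ⟨t, ht⟩ := huniq (fun x => m' (w x))
        (fun x hx => hm' x x.2 ((hmem x).2 hx)) ((hg _).2 ⟨m', fun _ => rfl⟩)
      refine ⟨t, fun x hx => ?_⟩
      have := congrFun ht ⟨x, hx⟩
      rw [Pi.smul_apply, hm, smul_eq_mul] at this
      exact this
    · rw [← hmem x]
      exact and_iff_right (vertexSet_subset_extremePoints x.2).1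
  choose! f hf hfC using hface
  have hinj : InjOn f 𝒞 := by
    intro C hC C' hC' h
    ext x
    rw [← not_iff_not, ← hfC C hC, ← hfC C' hC', h]
  have := ncard_le_ncard (image_subset_iff.2 hf : f '' 𝒞 ⊆ facetSet P) hP.finite_facetSet
  rw [hinj.ncard_image, ncard_coe_finset] at this
  omega
end

section
/- For every integer d ≥ 3, every 2-simplicial d-polytope with at least d+3 vertices has at least d+4 facets. -/
open Set

section ConeDecomposition

variable {G J : Type*} [AddCommGroup G] [Module ℝ G]

/-- A nonnegative linear inequality system decomposes every solution that is not determined up to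
scaling by its tight constraints into two solutions with more tight constraints. -/
lemma exists_decomposition [Fintype J] (e : J → Module.Dual ℝ G) {g w : G}
    (hg : ∀ j, 0 ≤ e j g) (hw : ∀ j, e j g = 0 → e j w = 0)
    (hne : ∀ c : ℝ, ∃ j, e j w ≠ c * e j g) :
    ∃ (a b : G) (t : ℝ), 0 ≤ t ∧ g = a + t • b ∧
      (∀ j, 0 ≤ e j a) ∧ (∀ j, 0 ≤ e j b) ∧
      (∀ j, e j g = 0 → e j a = 0 ∧ e j b = 0) ∧
      (∃ j, e j g ≠ 0 ∧ e j a = 0) ∧ (∃ j, e j g ≠ 0 ∧ e j b = 0) := by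
  classical
  let s : Finset J := Finset.univ.filter fun j => e j g ≠ 0
  have hs : s.Nonempty := by
    obtain ⟨j, hj⟩ := hne 0
    exact ⟨j, by simpa [s] using fun h => hj (by simp [hw j h])⟩
  obtain ⟨j₀, hj₀, hmin⟩ := s.exists_min_image (fun j => e j w / e j g) hs
  have hpos : ∀ j, e j g ≠ 0 → 0 < e j g := fun j h => lt_of_le_of_ne (hg j) (Ne.symm h)
  have hj₀' : e j₀ g ≠ 0 := by simpa [s] using hj₀
  set c := e j₀ w / e j₀ g with hc
  let b := w - c • g
  have hb : ∀ j, e j b = e j w - c * e j g := fun j => by simp [b]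
  have hb0 : ∀ j, 0 ≤ e j b := by
    intro j
    rw [hb]
    by_cases h : e j g = 0
    · simp [h, hw j h]
    · have := hmin j (by simpa [s] using h)
      have := (le_div_iff₀ (hpos j h)).1 this
      linarith
  let s' : Finset J := Finset.univ.filter fun j => e j b ≠ 0
  have hs' : s'.Nonempty := by
    obtain ⟨j, hj⟩ := hne c
    exact ⟨j, by simpa [s', hb] using sub_ne_zero.2 hj⟩
  obtain ⟨j₁, hj₁, hmin'⟩ := s'.exists_min_image (fun j => e j g / e j b) hs'
  have hbpos : ∀ j, e j b ≠ 0 → 0 < e j b := fun j h => lt_of_le_of_ne (hb0 j) (Ne.symm h)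
  have hj₁' : e j₁ b ≠ 0 := by simpa [s'] using hj₁
  set t := e j₁ g / e j₁ b with ht
  have hgb : ∀ j, e j g = 0 → e j b = 0 := fun j h => by simp [hb, h, hw j h]
  refine ⟨g - t • b, b, t, div_nonneg (hg _) (hb0 _), by abel, ?_, hb0, ?_, ⟨j₁, ?_, ?_⟩,
    ⟨j₀, hj₀', ?_⟩⟩
  · intro j
    simp only [map_sub, map_smul, smul_eq_mul]
    by_cases h : e j b = 0
    · simpa [h] using hg j
    · have := hmin' j (by simpa [s'] using h)
      have := (le_div_iff₀ (hbpos j h)).1 this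
      linarith
  · intro j h
    simp [h, hgb j h]
  · exact fun h => hj₁' (hgb j₁ h)
  · simp [ht, hj₁']
  · simp [hb, hc, hj₀']

/-- Solutions of a finite linear inequality system are sums of nonnegative multiples of solutions
that are determined up to scaling by their tight constraints. -/
lemma cone_induction [Finite J] (e : J → Module.Dual ℝ G) {Q : G → Prop}
    (hadd : ∀ a b, Q a → Q b → Q (a + b)) (hsmul : ∀ (c : ℝ) a, 0 ≤ c → Q a → Q (c • a))
    (hext : ∀ r, (∀ j, 0 ≤ e j r) →
      (∀ w, (∀ j, e j r = 0 → e j w = 0) → ∃ c : ℝ, ∀ j, e j w = c * e j r) → Q r)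
    (g : G) (hg : ∀ j, 0 ≤ e j g) : Q g := by
  classical
  have := Fintype.ofFinite J
  induction hn : (Finset.univ.filter fun j => e j g ≠ 0).card using Nat.strong_induction_on
    generalizing g with
  | _ n ih =>
    by_cases h : ∀ w, (∀ j, e j g = 0 → e j w = 0) → ∃ c : ℝ, ∀ j, e j w = c * e j g
    · exact hext g hg h
    · push Not at h
      obtain ⟨w, hw, hne⟩ := h
      obtain ⟨a, b, t, ht, rfl, ha, hb, hab, ⟨j, hj, hja⟩, ⟨k, hk, hkb⟩⟩ :=
        exists_decomposition e hg hw hne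
      refine hadd _ _ (ih _ ?_ a ha rfl) (hsmul _ _ ht (ih _ ?_ b hb rfl)) <;> rw [← hn] <;>
        refine Finset.card_lt_card (Finset.ssubset_iff_of_subset ?_ |>.2 ?_)
      · exact fun i hi => by simpa using fun h => (Finset.mem_filter.1 hi).2 (hab i
          (by simpa using h)).1
      · exact ⟨j, by simpa using hj, by simpa using hja⟩
      · exact fun i hi => by simpa using fun h => (Finset.mem_filter.1 hi).2 (hab i
          (by simpa using h)).2
      · exact ⟨k, by simpa using hk, by simpa using hkb⟩

end ConeDecomposition

lemma Set.ncard_ne_three_of_mem {α : Type*} {s : Set α} {a b c d : α} (ha : a ∈ s) (hb : b ∈ s)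
    (hc : c ∈ s) (hd : d ∈ s) (hab : a ≠ b) (hac : a ≠ c) (had : a ≠ d) (hbc : b ≠ c)
    (hbd : b ≠ d) (hcd : c ≠ d) : s.ncard ≠ 3 := by
  classical
  intro h3
  have hsub : (({a, b, c, d} : Finset α) : Set α) ⊆ s := by
    intro x hx
    simp only [Finset.coe_insert, Finset.coe_singleton, Set.mem_insert_iff,
      Set.mem_singleton_iff] at hx
    rcases hx with rfl | rfl | rfl | rfl <;> assumption
  have := Set.ncard_le_ncard hsub (Set.finite_of_ncard_ne_zero (by omega))
  rw [Set.ncard_coe_finset, Finset.card_insert_of_notMem (by simp [hab, hac, had]),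
    Finset.card_insert_of_notMem (by simp [hbc, hbd]), Finset.card_pair hcd] at this
  omega

section SlackCone

open Module

variable {V ι : Type*} [AddCommGroup V] [Module ℝ V]

/-- The vectors on which all constraints outside `I` are tight. -/
def tightSpace (f : ι → Dual ℝ V) (I : Finset ι) : Submodule ℝ V where
  carrier := {w | ∀ i ∉ I, f i w = 0}
  add_mem' ha hb i hi := by simp [ha i hi, hb i hi]
  zero_mem' i _ := by simp
  smul_mem' c a ha i hi := by simp [ha i hi]

variable {f : ι → Dual ℝ V} {h : Dual ℝ V}

lemma mem_tightSpace {I : Finset ι} {w : V} :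
    w ∈ tightSpace f I ↔ ∀ i ∉ I, f i w = 0 := Iff.rfl

lemma tightSpace_mono {I J : Finset ι} (hIJ : I ⊆ J) : tightSpace f I ≤ tightSpace f J :=
  fun _ hw i hi => hw i fun h => hi (hIJ h)

/-- The hypotheses saying that `{u | ∀ i, 0 ≤ f i u}` is a pointed cone on which `h` is positive. -/
def IsPositiveOn (f : ι → Dual ℝ V) (h : Dual ℝ V) : Prop :=
  ∀ u, u ≠ 0 → (∀ i, 0 ≤ f i u) → 0 < h u

lemma IsPositiveOn.eq_zero (hh : IsPositiveOn f h) {u : V} (hu : ∀ i, f i u = 0) : u = 0 := by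
  by_contra hne
  have h₁ := hh u hne fun i => (hu i).ge
  have h₂ := hh (-u) (neg_ne_zero.2 hne) fun i => by simp [hu i]
  rw [map_neg] at h₂
  linarith

lemma finrank_tightSpace_insert [FiniteDimensional ℝ V] [DecidableEq ι]
    {I : Finset ι} {l : ι} (hl : l ∉ I) {w : V}
    (hw : w ∈ tightSpace f (insert l I)) (hlw : f l w ≠ 0) :
    finrank ℝ (tightSpace f (insert l I)) = finrank ℝ (tightSpace f I) + 1 := by
  let T : tightSpace f (insert l I) →ₗ[ℝ] ℝ := (f l).comp (tightSpace f (insert l I)).subtype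
  have hT : LinearMap.range T = ⊤ := by
    refine LinearMap.range_eq_top.2 (LinearMap.surjective ?_)
    intro h0
    exact hlw (by simpa [T] using LinearMap.congr_fun h0 ⟨w, hw⟩)
  have hker : LinearMap.ker T = (tightSpace f I).comap (tightSpace f (insert l I)).subtype := by
    ext ⟨w, hw⟩
    simp only [LinearMap.mem_ker, T, Submodule.mem_comap, LinearMap.comp_apply,
      Submodule.subtype_apply]
    refine ⟨fun h i hi => ?_, fun h => h l hl⟩
    by_cases hil : i = l
    · exact hil ▸ h
    · exact hw i (by simp [hil, hi])
  have h₁ := T.finrank_range_add_finrank_ker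
  rw [hT, hker, finrank_top, finrank_self,
    (Submodule.comapSubtypeEquivOfLe (tightSpace_mono (Finset.subset_insert l I))).finrank_eq] at h₁
  omega

variable [Fintype ι]

open Classical in
/-- The constraints that are not tight at `u`. -/
noncomputable def slackSupport (f : ι → Dual ℝ V) (u : V) : Finset ι :=
  Finset.univ.filter fun i => f i u ≠ 0

/-- The extreme rays of the cone `{u | ∀ i, 0 ≤ f i u}`, normalized by `h`. -/
def coneVertices (f : ι → Dual ℝ V) (h : Dual ℝ V) : Set V :=
  {u | (∀ i, 0 ≤ f i u) ∧ h u = 1 ∧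
    ∀ w ∈ tightSpace f (slackSupport f u), ∃ c : ℝ, w = c • u}

lemma mem_slackSupport {u : V} {i : ι} : i ∈ slackSupport f u ↔ f i u ≠ 0 := by
  simp [slackSupport]

lemma mem_tightSpace_iff_subset {I : Finset ι} {w : V} :
    w ∈ tightSpace f I ↔ slackSupport f w ⊆ I := by
  simp only [mem_tightSpace, Finset.subset_iff, mem_slackSupport]
  exact forall_congr' fun i => not_imp_comm

lemma slackSupport_smul {c : ℝ} (hc : c ≠ 0) (u : V) :
    slackSupport f (c • u) = slackSupport f u := by
  ext i; simp [mem_slackSupport, hc]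

lemma slackSupport_add [DecidableEq ι] {u w : V} (hu : ∀ i, 0 ≤ f i u) (hw : ∀ i, 0 ≤ f i w) :
    slackSupport f (u + w) = slackSupport f u ∪ slackSupport f w := by
  ext i
  have := hu i
  have := hw i
  simp only [mem_slackSupport, Finset.mem_union, map_add]
  rw [← not_and_or, not_iff_not]
  constructor
  · intro h; constructor <;> linarith
  · rintro ⟨h₁, h₂⟩; linarith

lemma exists_pos_add_smul_nonneg {u w : V} (hu : ∀ i, 0 ≤ f i u)
    (hw : ∀ i, f i u = 0 → 0 ≤ f i w) :
    ∃ ε : ℝ, 0 < ε ∧ (∀ i, 0 ≤ f i (u + ε • w)) ∧ ∀ i, 0 < f i u → 0 < f i (u + ε • w) := by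
  have key : ∀ i, ∀ᶠ ε : ℝ in nhdsWithin 0 (Ioi 0),
      0 ≤ f i (u + ε • w) ∧ (0 < f i u → 0 < f i (u + ε • w)) := by
    intro i
    rcases (hu i).eq_or_lt with h0 | hpos
    · filter_upwards [self_mem_nhdsWithin] with ε hε
      have := mul_nonneg (le_of_lt hε) (hw i h0.symm)
      simp only [map_add, map_smul, smul_eq_mul, ← h0]
      exact ⟨by linarith, fun h => absurd h (lt_irrefl _)⟩
    · have hc : Continuous fun ε : ℝ => f i (u + ε • w) := by
        simp only [map_add, map_smul, smul_eq_mul]; fun_prop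
      have := (hc.tendsto 0).eventually (lt_mem_nhds (a := 0) (by simpa using hpos))
      filter_upwards [nhdsWithin_le_nhds this] with ε hε
      exact ⟨hε.le, fun _ => hε⟩
  obtain ⟨ε, hε, hpos⟩ := ((Filter.eventually_all.2 key).and self_mem_nhdsWithin).exists
  exact ⟨ε, hpos, fun i => (hε i).1, fun i => (hε i).2⟩

lemma coneVertices_ne_zero {u : V} (hu : u ∈ coneVertices f h) : u ≠ 0 := by
  rintro rfl
  simpa using hu.2.1

lemma coneVertices_pos {u : V} (hu : u ∈ coneVertices f h) {i : ι}
    (hi : i ∈ slackSupport f u) : 0 < f i u :=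
  lt_of_le_of_ne (hu.1 i) (Ne.symm (mem_slackSupport.1 hi))

lemma coneVertices_eq_of_subset {u v : V} (hu : u ∈ coneVertices f h)
    (hv : v ∈ coneVertices f h) (huv : slackSupport f u ⊆ slackSupport f v) : u = v := by
  obtain ⟨c, rfl⟩ := hv.2.2 u (mem_tightSpace_iff_subset.2 huv)
  have := hu.2.1
  rw [map_smul, hv.2.1, smul_eq_mul, mul_one] at this
  simp [this]

lemma coneVertices_not_subset {u v : V} (hu : u ∈ coneVertices f h)
    (hv : v ∈ coneVertices f h) (huv : u ≠ v) :
    ∃ i ∈ slackSupport f u, i ∉ slackSupport f v :=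
  Finset.not_subset.1 fun hs => huv (coneVertices_eq_of_subset hu hv hs)

lemma exists_coneVertex (hh : IsPositiveOn f h) {p : V} (hp : ∀ i, 0 ≤ f i p) {i : ι}
    (hi : i ∈ slackSupport f p) :
    ∃ u ∈ coneVertices f h, slackSupport f u ⊆ slackSupport f p ∧ i ∈ slackSupport f u := by
  classical
  suffices H : (∀ i, 0 ≤ f i p) ∧ ∀ i ∈ slackSupport f p,
      ∃ u ∈ coneVertices f h, slackSupport f u ⊆ slackSupport f p ∧ i ∈ slackSupport f u from
    H.2 i hi
  refine cone_induction f (Q := fun p => (∀ i, 0 ≤ f i p) ∧ ∀ i ∈ slackSupport f p,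
      ∃ u ∈ coneVertices f h, slackSupport f u ⊆ slackSupport f p ∧ i ∈ slackSupport f u)
      ?_ ?_ ?_ p hp
  · rintro a b ⟨ha, ha'⟩ ⟨hb, hb'⟩
    refine ⟨fun i => by simpa using add_nonneg (ha i) (hb i), fun i hi => ?_⟩
    rw [slackSupport_add ha hb] at hi ⊢
    rcases Finset.mem_union.1 hi with hi | hi
    · obtain ⟨u, hu, hs, hiu⟩ := ha' i hi
      exact ⟨u, hu, hs.trans Finset.subset_union_left, hiu⟩
    · obtain ⟨u, hu, hs, hiu⟩ := hb' i hi
      exact ⟨u, hu, hs.trans Finset.subset_union_right, hiu⟩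
  · rintro c a hc ⟨ha, ha'⟩
    refine ⟨fun i => by simpa using mul_nonneg hc (ha i), fun i hi => ?_⟩
    have hc0 : c ≠ 0 := by
      rintro rfl
      simp [mem_slackSupport] at hi
    rw [slackSupport_smul hc0] at hi ⊢
    exact ha' i hi
  · intro r hr hext
    refine ⟨hr, fun i hi => ?_⟩
    have hr0 : r ≠ 0 := by
      rintro rfl
      simp [mem_slackSupport] at hi
    have hpos := hh r hr0 hr
    have hs : slackSupport f ((h r)⁻¹ • r) = slackSupport f r :=
      slackSupport_smul (inv_ne_zero hpos.ne') r
    refine ⟨(h r)⁻¹ • r, ⟨fun j => ?_, by simp [hpos.ne'], fun w hw => ?_⟩, hs.subset, hs ▸ hi⟩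
    · simpa using mul_nonneg (inv_nonneg.2 hpos.le) (hr j)
    · rw [hs] at hw
      obtain ⟨c, hc⟩ := hext w fun j hj => hw j fun h => mem_slackSupport.1 h hj
      refine ⟨c * h r, ?_⟩
      rw [smul_smul, mul_assoc, mul_inv_cancel₀ hpos.ne', mul_one, ← sub_eq_zero]
      exact hh.eq_zero fun j => by simp [hc j]

lemma slackSupport_injOn : InjOn (slackSupport f) (coneVertices f h) :=
  fun _ hu _ hv huv => coneVertices_eq_of_subset hu hv huv.subset

lemma notMem_slackSupport {u : V} {i : ι} : i ∉ slackSupport f u ↔ f i u = 0 := by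
  simp [mem_slackSupport]

/-- Eliminating `i` and `j` from a path of three edges `a - i - j - b` in the graph of extreme rays
supported on pairs closes the path. -/
lemma exists_coneVertex_closing_path [DecidableEq ι] (hh : IsPositiveOn f h) {u v w : V}
    {i j a b : ι} (hu : u ∈ coneVertices f h) (hv : v ∈ coneVertices f h)
    (hw : w ∈ coneVertices f h) (su : slackSupport f u = {i, j})
    (sv : slackSupport f v = {i, a}) (sw : slackSupport f w = {j, b})
    (hij : i ≠ j) (hia : i ≠ a) (hja : j ≠ a) (hib : i ≠ b) :
    ∃ z ∈ coneVertices f h, slackSupport f z ⊆ {a, b} ∧ i ∉ slackSupport f z ∧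
      j ∉ slackSupport f z := by
  have pui := coneVertices_pos hu (i := i) (by simp [su])
  have puj := coneVertices_pos hu (i := j) (by simp [su])
  have pvi := coneVertices_pos hv (i := i) (by simp [sv])
  have pva := coneVertices_pos hv (i := a) (by simp [sv])
  have pwj := coneVertices_pos hw (i := j) (by simp [sw])
  let y : V := (f i u * f j w) • v - (f i v * f j w) • u + (f j u * f i v) • w
  have hy : ∀ k, f k y =
      f i u * f j w * f k v - f i v * f j w * f k u + f j u * f i v * f k w := by
    intro k; simp [y]
  have hyi : f i y = 0 := by
    have : f i w = 0 := notMem_slackSupport.1 (by simp [sw, hij, hib])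
    rw [hy, this]; ring
  have hyj : f j y = 0 := by
    have : f j v = 0 := notMem_slackSupport.1 (by simp [sv, hij.symm, hja])
    rw [hy, this]; ring
  have hy' : ∀ k, k ≠ i → k ≠ j → f k y = f i u * f j w * f k v + f j u * f i v * f k w := by
    intro k hki hkj
    have : f k u = 0 := notMem_slackSupport.1 (by simp [su, hki, hkj])
    rw [hy, this]; ring
  have hynn : ∀ k, 0 ≤ f k y := by
    intro k
    by_cases hki : k = i
    · rw [hki, hyi]
    by_cases hkj : k = j
    · rw [hkj, hyj]
    rw [hy' k hki hkj]
    have := hv.1 k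
    have := hw.1 k
    positivity
  have hya : 0 < f a y := by
    rw [hy' a hia.symm hja.symm]
    have := hw.1 a
    positivity
  obtain ⟨z, hz, hzy, -⟩ := exists_coneVertex hh hynn (mem_slackSupport.2 hya.ne')
  have hiz : i ∉ slackSupport f z := fun h => mem_slackSupport.1 (hzy h) hyi
  have hjz : j ∉ slackSupport f z := fun h => mem_slackSupport.1 (hzy h) hyj
  refine ⟨z, hz, fun k hk => ?_, hiz, hjz⟩
  have hki : k ≠ i := fun h => hiz (h ▸ hk)
  have hkj : k ≠ j := fun h => hjz (h ▸ hk)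
  by_contra hkab
  simp only [Finset.mem_insert, Finset.mem_singleton, not_or] at hkab
  refine mem_slackSupport.1 (hzy hk) ?_
  have h₁ : f k v = 0 := notMem_slackSupport.1 (by simp [sv, hki, hkab.1])
  have h₂ : f k w = 0 := notMem_slackSupport.1 (by simp [sw, hkj, hkab.2])
  rw [hy' k hki hkj, h₁, h₂]
  ring

lemma finite_coneVertices : (coneVertices f h).Finite :=
  Set.Finite.of_finite_image (Set.toFinite _) slackSupport_injOn

variable [FiniteDimensional ℝ V]

lemma finrank_tightSpace_slackSupport {u : V} (hu : u ∈ coneVertices f h) :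
    finrank ℝ (tightSpace f (slackSupport f u)) = 1 := by
  rw [finrank_eq_one_iff']
  refine ⟨⟨u, mem_tightSpace_iff_subset.2 subset_rfl⟩, ?_, ?_⟩
  · simpa using coneVertices_ne_zero hu
  · rintro ⟨w, hw⟩
    obtain ⟨c, rfl⟩ := hu.2.2 w hw
    exact ⟨c, rfl⟩

lemma finrank_le_finrank_tightSpace (I : Finset ι) :
    finrank ℝ V + I.card ≤ finrank ℝ (tightSpace f I) + Fintype.card ι := by
  classical
  let T : V →ₗ[ℝ] (↥(Iᶜ : Finset ι) → ℝ) := LinearMap.pi fun i => f i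
  have hker : LinearMap.ker T = tightSpace f I := by
    ext w
    simp [T, funext_iff, mem_tightSpace]
  have h₁ := T.finrank_range_add_finrank_ker
  have h₂ := (LinearMap.range T).finrank_le
  have h₃ := Finset.card_compl I
  have h₄ := I.card_le_univ
  rw [hker] at h₁
  simp only [finrank_fintype_fun_eq_card, Fintype.card_coe] at h₂
  omega

lemma exists_slackSupport_eq_insert [DecidableEq ι] {u : V} (hu : ∀ i, 0 ≤ f i u) {l : ι}
    (hl : l ∉ slackSupport f u)
    (hlt : finrank ℝ (tightSpace f (slackSupport f u)) <
      finrank ℝ (tightSpace f (insert l (slackSupport f u)))) :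
    ∃ p, (∀ i, 0 ≤ f i p) ∧ slackSupport f p = insert l (slackSupport f u) := by
  have hex : ∃ w ∈ tightSpace f (insert l (slackSupport f u)), f l w ≠ 0 := by
    by_contra! hall
    refine hlt.not_ge (Submodule.finrank_mono fun w hw i hi => ?_)
    by_cases hil : i = l
    · exact hil ▸ hall w hw
    · exact hw i (by simp [hil, hi])
  obtain ⟨w, hw, hlw⟩ : ∃ w ∈ tightSpace f (insert l (slackSupport f u)), 0 < f l w := by
    obtain ⟨w, hw, hlw⟩ := hex
    rcases lt_or_gt_of_ne hlw with h | h
    · exact ⟨-w, neg_mem hw, by simpa using h⟩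
    · exact ⟨w, hw, h⟩
  have hl0 : f l u = 0 := by simpa [mem_slackSupport] using hl
  obtain ⟨ε, hε, h₁, h₂⟩ := exists_pos_add_smul_nonneg (f := f) (w := w) hu (by
    intro i hi
    by_cases hil : i = l
    · exact hil ▸ hlw.le
    · exact (hw i (by simp [hil, mem_slackSupport, hi])).ge)
  refine ⟨_, h₁, Finset.Subset.antisymm ?_ ?_⟩
  · refine mem_tightSpace_iff_subset.1 (add_mem ?_ (Submodule.smul_mem _ _ hw))
    exact mem_tightSpace_iff_subset.2 (Finset.subset_insert _ _)
  · intro i hi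
    rw [mem_slackSupport]
    rcases Finset.mem_insert.1 hi with rfl | hi
    · simpa [hl0] using ⟨hε.ne', hlw.ne'⟩
    · exact (h₂ i (lt_of_le_of_ne (hu i) (Ne.symm (mem_slackSupport.1 hi)))).ne'

/-- Every three-dimensional face of the cone has exactly three extreme rays. -/
def IsTwoSimplicialCone (f : ι → Dual ℝ V) (h : Dual ℝ V) : Prop :=
  ∀ p, (∀ i, 0 ≤ f i p) → finrank ℝ (tightSpace f (slackSupport f p)) = 3 →
    {u ∈ coneVertices f h | slackSupport f u ⊆ slackSupport f p}.ncard = 3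

lemma card_slackSupport_le {u : V} (hu : u ∈ coneVertices f h) :
    finrank ℝ V + (slackSupport f u).card ≤ Fintype.card ι + 1 := by
  have := finrank_le_finrank_tightSpace (f := f) (slackSupport f u)
  rw [finrank_tightSpace_slackSupport hu] at this
  omega

/-- If each extreme ray misses at most two facets, then each extreme ray misses a facet that
contains all the others. -/
lemma exists_private_facet (hh : IsPositiveOn f h) (hs : IsTwoSimplicialCone f h)
    (hcard : ∀ u ∈ coneVertices f h, (slackSupport f u).card ≤ 2)
    {u : V} (hu : u ∈ coneVertices f h) :
    ∃ i ∈ slackSupport f u, ∀ v ∈ coneVertices f h, v ≠ u → i ∉ slackSupport f v := by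
  classical
  by_contra! hcon
  have hne : (slackSupport f u).Nonempty := by
    rw [Finset.nonempty_iff_ne_empty]
    intro h0
    exact coneVertices_ne_zero hu (hh.eq_zero fun i => notMem_slackSupport.1 (by simp [h0]))
  obtain ⟨i, hi⟩ := hne
  obtain ⟨v, hv, hvu, hiv⟩ := hcon i hi
  obtain ⟨j, hju, hjv⟩ := coneVertices_not_subset hu hv hvu.symm
  obtain ⟨w, hw, hwu, hjw⟩ := hcon j hju
  obtain ⟨a, hav, hau⟩ := coneVertices_not_subset hv hu hvu
  obtain ⟨b, hbw, hbu⟩ := coneVertices_not_subset hw hu hwu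
  have hij : i ≠ j := fun h => hjv (h ▸ hiv)
  have hia : i ≠ a := fun h => hau (h ▸ hi)
  have hja : j ≠ a := fun h => hau (h ▸ hju)
  have hib : i ≠ b := fun h => hbu (h ▸ hi)
  have hjb : j ≠ b := fun h => hbu (h ▸ hju)
  have pair : ∀ {x : V} {k l : ι}, x ∈ coneVertices f h → k ∈ slackSupport f x →
      l ∈ slackSupport f x → k ≠ l → slackSupport f x = {k, l} := by
    intro x k l hx hk hl hkl
    refine (Finset.eq_of_subset_of_card_le ?_ ?_).symm
    · simp [Finset.insert_subset_iff, hk, hl]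
    · rw [Finset.card_pair hkl]; exact hcard x hx
  have su := pair hu hi hju hij
  have sv := pair hv hiv hav hia
  have sw := pair hw hjw hbw hjb
  obtain ⟨z, hz, hzab, hiz, hjz⟩ :=
    exists_coneVertex_closing_path hh hu hv hw su sv sw hij hia hja hib
  by_cases hab : a = b
  · subst hab
    have : z = v := coneVertices_eq_of_subset hz hv (hzab.trans (by simp [sv]))
    exact hiz (this ▸ hiv)
  have svw : slackSupport f (v + w) = insert b (insert a {i, j}) := by
    rw [slackSupport_add hv.1 hw.1, sv, sw]
    ext k; simp only [Finset.mem_union, Finset.mem_insert, Finset.mem_singleton]; tauto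
  have su' : slackSupport f u ⊆ slackSupport f (v + w) := by
    rw [svw, su]
    exact (Finset.subset_insert _ _).trans (Finset.subset_insert _ _)
  have sv' : slackSupport f v ⊆ slackSupport f (v + w) := by
    rw [slackSupport_add hv.1 hw.1]; exact Finset.subset_union_left
  have sw' : slackSupport f w ⊆ slackSupport f (v + w) := by
    rw [slackSupport_add hv.1 hw.1]; exact Finset.subset_union_right
  have sz' : slackSupport f z ⊆ slackSupport f (v + w) := by
    rw [svw]
    refine hzab.trans ?_
    simp [Finset.insert_subset_iff]
  have r₁ : finrank ℝ (tightSpace f {i, j}) = 1 := su ▸ finrank_tightSpace_slackSupport hu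
  have r₂ := finrank_tightSpace_insert (f := f) (I := {i, j}) (l := a) (w := v)
    (by simp [hia.symm, hja.symm])
    (mem_tightSpace_iff_subset.2 (by rw [sv]; simp [Finset.insert_subset_iff]))
    (mem_slackSupport.1 hav)
  have r₃ := finrank_tightSpace_insert (f := f) (I := insert a {i, j}) (l := b) (w := w)
    (by simp [hib.symm, hjb.symm, Ne.symm hab])
    (mem_tightSpace_iff_subset.2 (by rw [sw]; simp [Finset.insert_subset_iff]))
    (mem_slackSupport.1 hbw)
  have h3 := hs (v + w) (fun k => by simpa using add_nonneg (hv.1 k) (hw.1 k))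
    (by rw [svw]; omega)
  exact Set.ncard_ne_three_of_mem
    (s := {x ∈ coneVertices f h | slackSupport f x ⊆ slackSupport f (v + w)})
    ⟨hz, sz'⟩ ⟨hu, su'⟩ ⟨hv, sv'⟩ ⟨hw, sw'⟩ (fun h => hiz (h ▸ hi)) (fun h => hiz (h ▸ hiv))
    (fun h => hjz (h ▸ hjw)) hvu.symm hwu.symm (fun h => hjv (h ▸ hjw)) h3

lemma ncard_coneVertices_le_of_card_slackSupport_le (hh : IsPositiveOn f h)
    (hs : IsTwoSimplicialCone f h)
    (hcard : ∀ u ∈ coneVertices f h, (slackSupport f u).card ≤ 2) :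
    (coneVertices f h).ncard ≤ finrank ℝ V := by
  classical
  have hli : LinearIndependent ℝ (fun u : coneVertices f h => (u : V)) := by
    rw [linearIndependent_iff']
    intro s g hg u hus
    obtain ⟨i, hi, hpriv⟩ := exists_private_facet hh hs hcard u.2
    have := congrArg (f i) hg
    rw [map_sum, map_zero, Finset.sum_eq_single u] at this
    · simpa [mem_slackSupport.1 hi] using this
    · intro v _ hvu
      have := hpriv v v.2 (fun h => hvu (Subtype.ext h))
      simp only [mem_slackSupport, not_not] at this
      simp [this]
    · exact fun h => absurd hus h
  have := (finite_coneVertices (f := f) (h := h)).fintype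
  have := hli.fintype_card_le_finrank
  rwa [Set.fintypeCard_eq_ncard] at this

/-- An extreme ray missing exactly three facets, in the critical codimension. -/
lemma simple_ray_ncard [DecidableEq ι] (hs : IsTwoSimplicialCone f h)
    (hι : Fintype.card ι = finrank ℝ V + 2) {v : V} (hv : v ∈ coneVertices f h)
    (hv3 : (slackSupport f v).card = 3) {l m : ι} (hl : l ∉ slackSupport f v)
    (hm : m ∉ slackSupport f v) (hlm : l ≠ m) :
    {u ∈ coneVertices f h | slackSupport f u ⊆ insert m (insert l (slackSupport f v))}.ncard = 3 ∧
    ∃ p, (∀ i, 0 ≤ f i p) ∧ slackSupport f p = insert l (slackSupport f v) := by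
  have r₁ := finrank_tightSpace_slackSupport hv
  have b₂ := finrank_le_finrank_tightSpace (f := f) (insert l (slackSupport f v))
  rw [Finset.card_insert_of_notMem hl] at b₂
  obtain ⟨p, hp, sp⟩ := exists_slackSupport_eq_insert hv.1 hl (by omega)
  have hlp : f l p ≠ 0 := mem_slackSupport.1 (by simp [sp])
  have r₂ := finrank_tightSpace_insert hl (mem_tightSpace_iff_subset.2 sp.subset) hlp
  have hmp : m ∉ slackSupport f p := by simp [sp, hm, hlm.symm]
  have b₃ := finrank_le_finrank_tightSpace (f := f) (insert m (slackSupport f p))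
  rw [Finset.card_insert_of_notMem hmp, sp, Finset.card_insert_of_notMem hl] at b₃
  obtain ⟨q, hq, sq⟩ := exists_slackSupport_eq_insert hp hmp (by rw [sp]; omega)
  have hmq : f m q ≠ 0 := mem_slackSupport.1 (by simp [sq])
  have r₃ := finrank_tightSpace_insert hmp (mem_tightSpace_iff_subset.2 sq.subset) hmq
  refine ⟨?_, p, hp, sp⟩
  have := hs q hq (by rw [sq, r₃, sp]; omega)
  rwa [sq, sp] at this

lemma simple_ray_structure (hh : IsPositiveOn f h) [DecidableEq ι] (hs : IsTwoSimplicialCone f h)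
    (hι : Fintype.card ι = finrank ℝ V + 2) {v : V} (hv : v ∈ coneVertices f h)
    (hv3 : (slackSupport f v).card = 3) {l m : ι} (hl : l ∉ slackSupport f v)
    (hm : m ∉ slackSupport f v) (hlm : l ≠ m) :
    ∃ w ∈ coneVertices f h, slackSupport f w \ slackSupport f v = {l} ∧
    ∀ u ∈ coneVertices f h, l ∈ slackSupport f u →
      slackSupport f u ⊆ insert m (insert l (slackSupport f v)) → u = w := by
  classical
  have key : ∀ k, k ∉ slackSupport f v → (∃ p, (∀ i, 0 ≤ f i p) ∧
      slackSupport f p = insert k (slackSupport f v)) →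
      ∃ w ∈ coneVertices f h, slackSupport f w ⊆ insert k (slackSupport f v) ∧
        k ∈ slackSupport f w := by
    rintro k hk ⟨p, hp, sp⟩
    rw [← sp]
    exact exists_coneVertex hh hp (by simp [sp])
  obtain ⟨h3, hpl⟩ := simple_ray_ncard hs hι hv hv3 hl hm hlm
  obtain ⟨-, hpm⟩ := simple_ray_ncard hs hι hv hv3 hm hl hlm.symm
  obtain ⟨w, hw, sw, hlw⟩ := key l hl hpl
  obtain ⟨x, hx, sx, hmx⟩ := key m hm hpm
  have hlx : l ∉ slackSupport f x := fun h => by simpa [hlm, hl] using sx h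
  have hwv : w ≠ v := fun h => hl (h ▸ hlw)
  have hxv : x ≠ v := fun h => hm (h ▸ hmx)
  have hwx : w ≠ x := fun h => hlx (h ▸ hlw)
  refine ⟨w, hw, ?_, ?_⟩
  · ext k
    simp only [Finset.mem_sdiff, Finset.mem_singleton]
    refine ⟨fun ⟨h₁, h₂⟩ => (Finset.mem_insert.1 (sw h₁)).resolve_right h₂, ?_⟩
    rintro rfl
    exact ⟨hlw, hl⟩
  · intro u hu hlu su
    by_contra huw
    have hux : u ≠ x := fun h => hlx (h ▸ hlu)
    have huv : u ≠ v := fun h => hl (h ▸ hlu)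
    exact Set.ncard_ne_three_of_mem
      (s := {u ∈ coneVertices f h | slackSupport f u ⊆ insert m (insert l (slackSupport f v))})
      ⟨hu, su⟩ ⟨hv, (Finset.subset_insert _ _).trans (Finset.subset_insert _ _)⟩
      ⟨hw, sw.trans (Finset.subset_insert _ _)⟩
      ⟨hx, sx.trans (Finset.insert_subset_insert _ (Finset.subset_insert _ _))⟩
      huv huw hux hwv.symm hxv.symm hwx h3

lemma card_slackSupport_sdiff_ne_two [DecidableEq ι] (hh : IsPositiveOn f h)
    (hs : IsTwoSimplicialCone f h)
    (hι : Fintype.card ι = finrank ℝ V + 2) {u v : V} (hv : v ∈ coneVertices f h)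
    (hv3 : (slackSupport f v).card = 3) (hu : u ∈ coneVertices f h) :
    (slackSupport f u \ slackSupport f v).card ≠ 2 := by
  intro h2
  obtain ⟨l, m, hlm, hd⟩ := Finset.card_eq_two.1 h2
  have hl : l ∈ slackSupport f u \ slackSupport f v := by simp [hd]
  have hm : m ∈ slackSupport f u \ slackSupport f v := by simp [hd]
  rw [Finset.mem_sdiff] at hl hm
  obtain ⟨w, -, hdw, huniq⟩ := simple_ray_structure hh hs hι hv hv3 hl.2 hm.2 hlm
  have huw := huniq u hu hl.1 fun k hk => by
    by_cases hkv : k ∈ slackSupport f v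
    · simp [hkv]
    · have : k ∈ slackSupport f u \ slackSupport f v := Finset.mem_sdiff.2 ⟨hk, hkv⟩
      rw [hd] at this
      simp only [Finset.mem_insert, Finset.mem_singleton] at this ⊢
      tauto
  rw [huw, hdw, Finset.card_singleton] at h2
  omega

lemma exists_coneVertex_sdiff_eq_singleton [DecidableEq ι] (hh : IsPositiveOn f h)
    (hs : IsTwoSimplicialCone f h)
    (hι : Fintype.card ι = finrank ℝ V + 2) (hV : 3 ≤ finrank ℝ V) {v : V}
    (hv : v ∈ coneVertices f h) (hv3 : (slackSupport f v).card = 3) {l : ι}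
    (hl : l ∉ slackSupport f v) :
    ∃ w ∈ coneVertices f h, slackSupport f w \ slackSupport f v = {l} ∧
      ∀ u ∈ coneVertices f h, slackSupport f u \ slackSupport f v = {l} → u = w := by
  obtain ⟨m, hm⟩ : ∃ m, m ∉ insert l (slackSupport f v) := by
    by_contra! hall
    have := Finset.card_le_card (s := Finset.univ) fun x _ => hall x
    rw [Finset.card_univ, Finset.card_insert_of_notMem hl] at this
    omega
  rw [Finset.mem_insert, not_or] at hm
  obtain ⟨w, hw, hdw, huniq⟩ := simple_ray_structure hh hs hι hv hv3 hl hm.2 (Ne.symm hm.1)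
  refine ⟨w, hw, hdw, fun u hu hdu => huniq u hu ?_ fun k hk => ?_⟩
  · have : l ∈ slackSupport f u \ slackSupport f v := by simp [hdu]
    exact (Finset.mem_sdiff.1 this).1
  · by_cases hkv : k ∈ slackSupport f v
    · simp [hkv]
    · have : k ∈ slackSupport f u \ slackSupport f v := Finset.mem_sdiff.2 ⟨hk, hkv⟩
      rw [hdu] at this
      simp [Finset.mem_singleton.1 this]

/-- At most one extreme ray misses three facets all of which contain a given simple ray. -/
lemma subsingleton_disjoint_simple_rays [DecidableEq ι] (hh : IsPositiveOn f h)
    (hs : IsTwoSimplicialCone f h)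
    (hι : Fintype.card ι = finrank ℝ V + 2) (hV : 3 ≤ finrank ℝ V) {v : V}
    (hv : v ∈ coneVertices f h) (hv3 : (slackSupport f v).card = 3) :
    {u ∈ coneVertices f h | (slackSupport f u \ slackSupport f v).card = 3}.Subsingleton := by
  have hle : ∀ x ∈ coneVertices f h, (slackSupport f x).card ≤ 3 := fun x hx => by
    have := card_slackSupport_le hx
    omega
  have hdisj : ∀ {x y : V}, x ∈ coneVertices f h →
      (slackSupport f x \ slackSupport f y).card = 3 →
      slackSupport f x \ slackSupport f y = slackSupport f x := fun hx hc =>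
    Finset.eq_of_subset_of_card_le Finset.sdiff_subset (by rw [hc]; exact hle _ hx)
  rintro u ⟨hu, hu3⟩ u' ⟨hu', hu3'⟩
  by_contra hne
  have du := hdisj hu hu3
  have du' := hdisj hu' hu3'
  rw [du] at hu3
  rw [du'] at hu3'
  obtain ⟨e, heu, heu'⟩ := coneVertices_not_subset hu hu' hne
  have hev : e ∉ slackSupport f v := by
    rw [← du] at heu
    exact (Finset.mem_sdiff.1 heu).2
  obtain ⟨w, hw, hdw, -⟩ := exists_coneVertex_sdiff_eq_singleton hh hs hι hV hv hv3 hev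
  have hew : e ∈ slackSupport f w := by
    have : e ∈ slackSupport f w \ slackSupport f v := by simp [hdw]
    exact (Finset.mem_sdiff.1 this).1
  have hwe : ∀ k ∈ slackSupport f w, k ∉ slackSupport f v → k = e := fun k hk hkv => by
    have : k ∈ slackSupport f w \ slackSupport f v := Finset.mem_sdiff.2 ⟨hk, hkv⟩
    rw [hdw] at this
    exact Finset.mem_singleton.1 this
  have hwu' : slackSupport f w \ slackSupport f u' = slackSupport f w := by
    refine Finset.sdiff_eq_self_of_disjoint (Finset.disjoint_left.2 fun k hk hku' => ?_)
    rw [← du'] at hku'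
    exact heu' (hwe k hk (Finset.mem_sdiff.1 hku').2 ▸ (Finset.mem_sdiff.1 hku').1)
  have hwu : slackSupport f w \ slackSupport f u = (slackSupport f w).erase e := by
    ext k
    simp only [Finset.mem_sdiff, Finset.mem_erase]
    constructor
    · rintro ⟨h₁, h₂⟩
      exact ⟨fun h => h₂ (h ▸ heu), h₁⟩
    · rintro ⟨h₁, h₂⟩
      refine ⟨h₂, fun h₃ => h₁ (hwe k h₂ ?_)⟩
      rw [← du] at h₃
      exact (Finset.mem_sdiff.1 h₃).2
  have n₁ := card_slackSupport_sdiff_ne_two hh hs hι hu' hu3' hw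
  have n₂ := card_slackSupport_sdiff_ne_two hh hs hι hu hu3 hw
  rw [hwu'] at n₁
  rw [hwu, Finset.card_erase_of_mem hew] at n₂
  have n₃ := hle w hw
  have n₄ : (slackSupport f w).card ≠ 0 := Finset.card_ne_zero_of_mem hew
  have n₅ : (slackSupport f w).card ≠ 1 := fun h1 => by
    have hs1 : slackSupport f w ⊆ slackSupport f u := by
      obtain ⟨x, hx⟩ := Finset.card_eq_one.1 h1
      rw [hx] at hew ⊢
      rw [← Finset.mem_singleton.1 hew]
      simpa using heu
    have := coneVertices_eq_of_subset hw hu hs1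
    rw [this] at h1
    omega
  omega

lemma ncard_coneVertices_le_of_simple (hh : IsPositiveOn f h)
    (hs : IsTwoSimplicialCone f h)
    (hι : Fintype.card ι = finrank ℝ V + 2) (hV : 3 ≤ finrank ℝ V) {v : V}
    (hv : v ∈ coneVertices f h) (hv3 : (slackSupport f v).card = 3) :
    (coneVertices f h).ncard ≤ finrank ℝ V + 1 := by
  classical
  let B := {u ∈ coneVertices f h | (slackSupport f u \ slackSupport f v).card = 1}
  let C := {u ∈ coneVertices f h | (slackSupport f u \ slackSupport f v).card = 3}
  have hsub : coneVertices f h ⊆ insert v (B ∪ C) := by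
    intro u hu
    have h₁ := card_slackSupport_le hu
    have h₂ := Finset.card_le_card
      (Finset.sdiff_subset (s := slackSupport f u) (t := slackSupport f v))
    have h₃ := card_slackSupport_sdiff_ne_two hh hs hι hv hv3 hu
    have h₄ : (slackSupport f u \ slackSupport f v).card = 0 ∨
        (slackSupport f u \ slackSupport f v).card = 1 ∨
        (slackSupport f u \ slackSupport f v).card = 3 := by omega
    rcases h₄ with h | h | h
    · exact Or.inl (coneVertices_eq_of_subset hu hv
        (Finset.sdiff_eq_empty_iff_subset.1 (Finset.card_eq_zero.1 h)))
    · exact Or.inr (Or.inl ⟨hu, h⟩)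
    · exact Or.inr (Or.inr ⟨hu, h⟩)
  have hfin : (B ∪ C).Finite :=
    finite_coneVertices.subset (Set.union_subset (Set.sep_subset _ _) (Set.sep_subset _ _))
  have : Finite C := hfin.subset Set.subset_union_right
  have hC : C.ncard ≤ 1 :=
    Set.ncard_le_one_iff_subsingleton.2
      (subsingleton_disjoint_simple_rays hh hs hι hV hv hv3)
  have hB : B.ncard ≤ (slackSupport f v)ᶜ.card := by
    have hchoose : ∀ l : ι, l ∉ slackSupport f v → ∃ w, ∀ u ∈ coneVertices f h,
        slackSupport f u \ slackSupport f v = {l} → u = w := fun l hl => by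
      obtain ⟨w, -, -, hw⟩ := exists_coneVertex_sdiff_eq_singleton hh hs hι hV hv hv3 hl
      exact ⟨w, hw⟩
    have hinj : InjOn (fun u => slackSupport f u \ slackSupport f v) B := by
      rintro u ⟨hu, hu1⟩ u' ⟨hu', -⟩ huu'
      obtain ⟨l, hl⟩ := Finset.card_eq_one.1 hu1
      have hlv : l ∉ slackSupport f v := by
        have : l ∈ slackSupport f u \ slackSupport f v := by simp [hl]
        exact (Finset.mem_sdiff.1 this).2
      obtain ⟨w, hw⟩ := hchoose l hlv
      rw [hw u hu hl, hw u' hu' (huu'.symm.trans hl)]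
    have hmaps : ∀ u ∈ B, slackSupport f u \ slackSupport f v ∈
        (((slackSupport f v)ᶜ.powersetCard 1 : Finset (Finset ι)) : Set (Finset ι)) := by
      rintro u ⟨-, hu1⟩
      rw [Finset.mem_coe, Finset.mem_powersetCard]
      exact ⟨fun k hk => Finset.mem_compl.2 (Finset.mem_sdiff.1 hk).2, hu1⟩
    have := Set.ncard_le_ncard_of_injOn _ hmaps hinj (Finset.finite_toSet _)
    rwa [Set.ncard_coe_finset, Finset.card_powersetCard, Nat.choose_one_right] at this
  have h₁ := Set.ncard_le_ncard hsub (hfin.insert v)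
  have h₂ := Set.ncard_insert_le v (B ∪ C)
  have h₃ := Set.ncard_union_le B C
  rw [Finset.card_compl, hv3] at hB
  omega

/-- A pointed cone of dimension at least three whose three-dimensional faces have three extreme
rays, and that is cut out by at most two inequalities more than its dimension, has at most one
extreme ray more than its dimension. -/
theorem ncard_coneVertices_le (hh : IsPositiveOn f h) (hs : IsTwoSimplicialCone f h)
    (hι : Fintype.card ι ≤ finrank ℝ V + 2) (hV : 3 ≤ finrank ℝ V) :
    (coneVertices f h).ncard ≤ finrank ℝ V + 1 := by
  by_cases hcard : ∀ u ∈ coneVertices f h, (slackSupport f u).card ≤ 2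
  · exact (ncard_coneVertices_le_of_card_slackSupport_le hh hs hcard).trans (Nat.le_succ _)
  · push Not at hcard
    obtain ⟨v, hv, hv3⟩ := hcard
    have := card_slackSupport_le hv
    exact ncard_coneVertices_le_of_simple hh hs (by omega) hV hv (by omega)

end SlackCone

section Homogenization

open Module

variable {N : ℕ}

/-- The embedding of `ℝ^N` as the affine hyperplane at height one. -/
def homogenize (x : Fin N → ℝ) : (Fin N → ℝ) × ℝ := (x, 1)

/-- The linear hull of the homogenization of a set. -/
def homSpan (X : Set (Fin N → ℝ)) : Submodule ℝ ((Fin N → ℝ) × ℝ) :=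
  Submodule.span ℝ (homogenize '' X)

lemma homogenize_mem_homSpan {X : Set (Fin N → ℝ)} {x : Fin N → ℝ} (hx : x ∈ X) :
    homogenize x ∈ homSpan X := Submodule.subset_span (mem_image_of_mem _ hx)

lemma homSpan_le {X : Set (Fin N → ℝ)} {W : Submodule ℝ ((Fin N → ℝ) × ℝ)} :
    homSpan X ≤ W ↔ ∀ x ∈ X, homogenize x ∈ W := by
  rw [homSpan, Submodule.span_le, image_subset_iff]; rfl

lemma finrank_homSpan {X : Set (Fin N → ℝ)} (hX : X.Nonempty) :
    finrank ℝ (homSpan X) = pdim X + 1 := by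
  obtain ⟨x₀, hx₀⟩ := hX
  let e : (vectorSpan ℝ X) × ℝ →ₗ[ℝ] (Fin N → ℝ) × ℝ :=
    ((LinearMap.inl ℝ (Fin N → ℝ) ℝ).comp (vectorSpan ℝ X).subtype).coprod
      (LinearMap.toSpanSingleton ℝ _ (homogenize x₀))
  have he : ∀ v t, e (v, t) = ((v : Fin N → ℝ) + t • x₀, t) := by
    intro v t; simp [e, homogenize]
  have hinj : Function.Injective e := by
    rw [injective_iff_map_eq_zero]
    rintro ⟨v, t⟩ h
    rw [he, Prod.mk_eq_zero] at h
    obtain ⟨h₁, rfl⟩ := h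
    simpa using h₁
  have hrange : LinearMap.range e = homSpan X := by
    apply le_antisymm
    · rintro _ ⟨⟨v, t⟩, rfl⟩
      have hv : vectorSpan ℝ X ≤ (homSpan X).comap (LinearMap.inl ℝ (Fin N → ℝ) ℝ) := by
        rw [vectorSpan_def, Submodule.span_le]
        rintro _ ⟨x, hx, y, hy, rfl⟩
        have := sub_mem (homogenize_mem_homSpan hx) (homogenize_mem_homSpan hy)
        simpa [homogenize] using this
      have := add_mem (Submodule.mem_comap.1 (hv v.2))
        ((homSpan X).smul_mem t (homogenize_mem_homSpan hx₀))
      rw [he]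
      simpa [homogenize] using this
    · rw [homSpan_le]
      intro x hx
      refine ⟨(⟨x - x₀, vsub_mem_vectorSpan ℝ hx hx₀⟩, 1), ?_⟩
      rw [he]
      simp [homogenize]
  rw [← hrange, LinearMap.finrank_range_of_inj hinj, finrank_prod, finrank_self, pdim,
    direction_affineSpan]

lemma isExposed_iff_exists_dual {P F : Set (Fin N → ℝ)} (hF : F.Nonempty) :
    IsExposed ℝ P F ↔ ∃ φ : Dual ℝ ((Fin N → ℝ) × ℝ),
      (∀ x ∈ P, 0 ≤ φ (homogenize x)) ∧ F = {x ∈ P | φ (homogenize x) = 0} := by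
  constructor
  · intro h
    obtain ⟨l, hl⟩ := h hF
    obtain ⟨x₀, hx₀⟩ := hF
    have hx₀' := hx₀
    rw [hl] at hx₀'
    refine ⟨l x₀ • LinearMap.snd ℝ _ _ - (l : (Fin N → ℝ) →ₗ[ℝ] ℝ).comp (LinearMap.fst ℝ _ _),
      fun x hx => by simpa [homogenize] using hx₀'.2 x hx, ?_⟩
    rw [hl]
    ext x
    simp only [homogenize, mem_ofPred_eq, LinearMap.sub_apply, LinearMap.smul_apply,
      LinearMap.snd_apply, LinearMap.comp_apply, LinearMap.fst_apply, smul_eq_mul, mul_one,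
      ContinuousLinearMap.coe_coe]
    refine and_congr_right fun hx => ⟨fun h => ?_, fun h y hy => ?_⟩
    · linarith [h x₀ hx₀'.1, hx₀'.2 x hx]
    · linarith [hx₀'.2 y hy]
  · rintro ⟨φ, hφ, rfl⟩ -
    obtain ⟨x₀, hx₀, hx₀'⟩ := hF
    let l : (Fin N → ℝ) →ₗ[ℝ] ℝ := -(φ.comp (LinearMap.inl ℝ _ _))
    have hl : ∀ x, φ (homogenize x) = φ (0, 1) - l x := by
      intro x
      have : homogenize x = (x, 0) + (0, 1) := by simp [homogenize]
      rw [this, map_add]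
      simp [l, add_comm]
    refine ⟨LinearMap.toContinuousLinearMap l, ?_⟩
    ext x
    simp only [mem_ofPred_eq, LinearMap.coe_toContinuousLinearMap']
    refine and_congr_right fun hx => ⟨fun h y hy => ?_, fun h => ?_⟩
    · have := hφ y hy
      rw [hl] at this h
      linarith
    · have h₁ := hφ x hx
      have h₂ := h x₀ hx₀
      rw [hl] at h₁ hx₀' ⊢
      linarith

lemma convex_setOf_dual_nonneg (φ : Dual ℝ ((Fin N → ℝ) × ℝ)) :
    Convex ℝ {x : Fin N → ℝ | 0 ≤ φ (homogenize x)} := by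
  intro x hx y hy a b ha hb hab
  have : homogenize (a • x + b • y) = a • homogenize x + b • homogenize y := by
    simp [homogenize, hab]
  simp only [mem_ofPred_eq] at hx hy ⊢
  rw [this, map_add, map_smul, map_smul, smul_eq_mul, smul_eq_mul]
  positivity

lemma homSpan_convexHull (X : Set (Fin N → ℝ)) : homSpan (convexHull ℝ X) = homSpan X := by
  apply le_antisymm
  · rw [homSpan_le]
    have : Convex ℝ {x : Fin N → ℝ | homogenize x ∈ homSpan X} := by
      intro x hx y hy a b _ _ hab
      have : homogenize (a • x + b • y) = a • homogenize x + b • homogenize y := by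
        simp [homogenize, hab]
      rw [mem_ofPred_eq, this]
      exact add_mem (Submodule.smul_mem _ _ hx) (Submodule.smul_mem _ _ hy)
    exact fun x hx => convexHull_min (fun y hy => homogenize_mem_homSpan hy) this hx
  · exact homSpan_le.2 fun x hx => homogenize_mem_homSpan (subset_convexHull ℝ X hx)

lemma finite_setOf_isExposed {S : Finset (Fin N → ℝ)} :
    {F | IsExposed ℝ (convexHull ℝ (S : Set (Fin N → ℝ))) F}.Finite := by
  have hc : IsCompact (convexHull ℝ (S : Set (Fin N → ℝ))) :=
    Set.Finite.isCompact_convexHull ℝ S.finite_toSet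
  refine Set.Finite.of_injOn (f := fun F => extremePoints ℝ F)
    (t := {T | T ⊆ (S : Set (Fin N → ℝ))}) ?_ ?_ S.finite_toSet.finite_subsets
  · intro F hF
    exact (IsExposed.isExtreme hF).extremePoints_subset_extremePoints.trans
      extremePoints_convexHull_subset
  · intro F hF G hG hFG
    rw [← closure_convexHull_extremePoints (IsExposed.isCompact hF hc)
        (IsExposed.convex hF (convex_convexHull ℝ _)),
      ← closure_convexHull_extremePoints (IsExposed.isCompact hG hc)
        (IsExposed.convex hG (convex_convexHull ℝ _))]
    exact congrArg _ (congrArg _ hFG)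

/-- Every linear functional that is nonnegative on a polytope is a nonnegative combination of facet
functionals. -/
lemma exists_nonneg_combination_facets {S : Finset (Fin N → ℝ)} {P : Set (Fin N → ℝ)}
    (hP : P = convexHull ℝ (S : Set (Fin N → ℝ))) (hd : 1 ≤ pdim P) [Fintype (facetSet P)]
    (f : facetSet P → Dual ℝ ((Fin N → ℝ) × ℝ))
    (hf : ∀ F, ∀ x ∈ P, 0 ≤ f F (homogenize x))
    (hfF : ∀ F : facetSet P, (F : Set (Fin N → ℝ)) = {x ∈ P | f F (homogenize x) = 0})
    (φ : Dual ℝ ((Fin N → ℝ) × ℝ)) (hφ : ∀ x ∈ P, 0 ≤ φ (homogenize x)) :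
    ∃ c : facetSet P → ℝ, (∀ F, 0 ≤ c F) ∧ ∀ u ∈ homSpan P, φ u = ∑ F, c F * f F u := by
  classical
  have hSP : (S : Set (Fin N → ℝ)) ⊆ P := hP ▸ subset_convexHull ℝ _
  have hspan : homSpan P = homSpan (S : Set (Fin N → ℝ)) := hP ▸ homSpan_convexHull _
  have hext : ∀ {α β : Dual ℝ ((Fin N → ℝ) × ℝ)},
      (∀ s ∈ S, α (homogenize s) = β (homogenize s)) → ∀ u ∈ homSpan P, α u = β u := by
    intro α β h
    have : homSpan P ≤ LinearMap.ker (α - β) := by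
      rw [hspan, homSpan_le]
      intro s hs
      simp [h s hs]
    exact fun u hu => by simpa [sub_eq_zero] using this hu
  have hnn : ∀ {α : Dual ℝ ((Fin N → ℝ) × ℝ)},
      (∀ s ∈ S, 0 ≤ α (homogenize s)) → ∀ x ∈ P, 0 ≤ α (homogenize x) := by
    intro α h x hx
    exact convexHull_min (s := (S : Set (Fin N → ℝ))) h (convex_setOf_dual_nonneg α) (hP ▸ hx)
  let e : S → Dual ℝ (Dual ℝ ((Fin N → ℝ) × ℝ)) := fun s => Dual.eval ℝ _ (homogenize s.1)
  refine cone_induction e (Q := fun φ => ∃ c : facetSet P → ℝ, (∀ F, 0 ≤ c F) ∧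
    ∀ u ∈ homSpan P, φ u = ∑ F, c F * f F u) ?_ ?_ ?_ φ fun s => hφ s (hSP s.2)
  · rintro α β ⟨a, ha, ha'⟩ ⟨b, hb, hb'⟩
    exact ⟨a + b, fun F => add_nonneg (ha F) (hb F), fun u hu => by
      simp [ha' u hu, hb' u hu, add_mul, Finset.sum_add_distrib]⟩
  · rintro r α hr ⟨a, ha, ha'⟩
    exact ⟨r • a, fun F => mul_nonneg hr (ha F), fun u hu => by
      simp [ha' u hu, Finset.mul_sum, mul_assoc]⟩
  · intro α hα hαext
    replace hα : ∀ x ∈ P, 0 ≤ α (homogenize x) := hnn fun s hs => hα ⟨s, hs⟩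
    by_cases h0 : ∀ u ∈ homSpan P, α u = 0
    · exact ⟨0, fun _ => le_rfl, fun u hu => by simp [h0 u hu]⟩
    obtain ⟨p₀, hp₀, hp₀'⟩ : ∃ x ∈ P, α (homogenize x) ≠ 0 := by
      by_contra! hall
      have : homSpan P ≤ LinearMap.ker α := homSpan_le.2 hall
      exact h0 fun u hu => this hu
    let T : Set (Fin N → ℝ) := {s | s ∈ S ∧ α (homogenize s) = 0}
    have hT : homSpan T = homSpan P ⊓ LinearMap.ker α := by
      apply le_antisymm
      · exact homSpan_le.2 fun s hs => ⟨homogenize_mem_homSpan (hSP hs.1), hs.2⟩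
      · rintro u ⟨hu, huα⟩
        by_contra hcon
        obtain ⟨z, hz, hzT⟩ := Submodule.exists_le_ker_of_notMem hcon
        obtain ⟨c, hc⟩ := hαext z fun s hs =>
          hzT (homogenize_mem_homSpan (X := T) ⟨s.2, hs⟩)
        have := hext (α := z) (β := c • α) (fun s hs => by simpa [e] using hc ⟨s, hs⟩) u hu
        rw [LinearMap.smul_apply, LinearMap.mem_ker.1 huα, smul_zero] at this
        exact hz this
    have hdim : finrank ℝ ↥(homSpan P ⊓ LinearMap.ker α) + 1 = pdim P + 1 := by
      rw [← finrank_homSpan ⟨p₀, hp₀⟩]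
      have hne : α.comp (homSpan P).subtype ≠ 0 := fun h =>
        hp₀' (LinearMap.congr_fun h ⟨_, homogenize_mem_homSpan hp₀⟩)
      rw [← Module.Dual.finrank_ker_add_one_of_ne_zero hne, LinearMap.ker_comp,
        ← LinearEquiv.finrank_eq (Submodule.equivSubtypeMap (homSpan P)
          (Submodule.comap (homSpan P).subtype (LinearMap.ker α))).symm,
        Submodule.map_comap_subtype]
    have hTne : T.Nonempty := by
      by_contra hemp
      rw [not_nonempty_iff_eq_empty] at hemp
      rw [← hT, hemp] at hdim
      rw [homSpan, image_empty, Submodule.span_empty, finrank_bot] at hdim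
      omega
    let F : Set (Fin N → ℝ) := {x ∈ P | α (homogenize x) = 0}
    have hTF : T ⊆ F := fun s hs => ⟨hSP hs.1, hs.2⟩
    have hFne : F.Nonempty := hTne.mono hTF
    have hFspan : homSpan F = homSpan P ⊓ LinearMap.ker α := by
      apply le_antisymm
      · exact homSpan_le.2 fun s hs => ⟨homogenize_mem_homSpan hs.1, hs.2⟩
      · rw [← hT]
        exact homSpan_le.2 fun s hs => homogenize_mem_homSpan (hTF hs)
    have hFfacet : F ∈ facetSet P := by
      refine ⟨(isExposed_iff_exists_dual hFne).2 ⟨α, hα, rfl⟩, hFne, ?_⟩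
      have := finrank_homSpan hFne
      rw [hFspan] at this
      omega
    let G : facetSet P := ⟨F, hFfacet⟩
    have hG : ∀ x ∈ P, f G (homogenize x) = 0 ↔ α (homogenize x) = 0 := by
      intro x hx
      have h₁ : x ∈ F ↔ x ∈ P ∧ f G (homogenize x) = 0 := Set.ext_iff.1 (hfF G) x
      have h₂ : x ∈ F ↔ x ∈ P ∧ α (homogenize x) = 0 := Iff.rfl
      simpa [hx] using h₁.symm.trans h₂
    obtain ⟨c, hc⟩ := hαext (f G) fun s hs => (hG s (hSP s.2)).2 hs
    have hcU := hext (α := f G) (β := c • α) fun s hs => by simpa [e] using hc ⟨s, hs⟩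
    have hcp := hcU _ (homogenize_mem_homSpan hp₀)
    rw [LinearMap.smul_apply, smul_eq_mul] at hcp
    have hfp : 0 < f G (homogenize p₀) :=
      lt_of_le_of_ne (hf G p₀ hp₀) (Ne.symm fun h => hp₀' ((hG p₀ hp₀).1 h))
    have hcpos : 0 < c := by
      have := hα p₀ hp₀
      by_contra! hle
      nlinarith
    refine ⟨Pi.single G c⁻¹, fun H => ?_, fun u hu => ?_⟩
    · by_cases hH : H = G
      · subst hH; simpa using hcpos.le
      · simp [Pi.single_eq_of_ne hH]
    · rw [Finset.sum_eq_single G (fun H _ hH => by simp [Pi.single_eq_of_ne hH])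
        (fun h => absurd (Finset.mem_univ _) h), Pi.single_eq_same, hcU u hu]
      simp [hcpos.ne']

end Homogenization

section FacetDescription

open Module

variable {N : ℕ} {ι : Type*} {P : Set (Fin N → ℝ)} {f : ι → Dual ℝ ((Fin N → ℝ) × ℝ)}

/-- The restrictions of functionals to the linear hull of the homogenization of `P`. -/
def restrictFunctional (P : Set (Fin N → ℝ)) (f : ι → Dual ℝ ((Fin N → ℝ) × ℝ)) (i : ι) :
    Dual ℝ (homSpan P) := (f i).comp (homSpan P).subtype

/-- The height coordinate on the linear hull of the homogenization of `P`. -/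
def height (P : Set (Fin N → ℝ)) : Dual ℝ (homSpan P) :=
  (LinearMap.snd ℝ (Fin N → ℝ) ℝ).comp (homSpan P).subtype

/-- The point at height one lying over a point of `P`. -/
def liftPoint {x : Fin N → ℝ} (hx : x ∈ P) : homSpan P :=
  ⟨homogenize x, homogenize_mem_homSpan hx⟩

@[simp] lemma restrictFunctional_apply (i : ι) (u : homSpan P) :
    restrictFunctional P f i u = f i u := rfl

@[simp] lemma height_apply (u : homSpan P) : height P u = (u : (Fin N → ℝ) × ℝ).2 := rfl

@[simp] lemma coe_liftPoint {x : Fin N → ℝ} (hx : x ∈ P) :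
    (liftPoint hx : (Fin N → ℝ) × ℝ) = homogenize x := rfl

lemma homogenize_fst {u : homSpan P} (hu : height P u = 1) :
    homogenize (u : (Fin N → ℝ) × ℝ).1 = u :=
  Prod.ext rfl hu.symm

variable [Fintype ι]

/-- Functionals that are nonnegative on the compact convex set `P` and generate all functionals
with this property. -/
structure IsFacetDescription (P : Set (Fin N → ℝ))
    (f : ι → Dual ℝ ((Fin N → ℝ) × ℝ)) : Prop where
  isCompact : IsCompact P
  convex : Convex ℝ P
  nonneg : ∀ i, ∀ x ∈ P, 0 ≤ f i (homogenize x)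
  generates : ∀ φ : Dual ℝ ((Fin N → ℝ) × ℝ), (∀ x ∈ P, 0 ≤ φ (homogenize x)) →
    ∃ c : ι → ℝ, (∀ i, 0 ≤ c i) ∧ ∀ u ∈ homSpan P, φ u = ∑ i, c i * f i u

/-- The subset of `P` on which all the functionals outside `I` vanish. -/
def tightFace (P : Set (Fin N → ℝ)) (f : ι → Dual ℝ ((Fin N → ℝ) × ℝ)) (I : Finset ι) :
    Set (Fin N → ℝ) :=
  {x ∈ P | ∀ i ∉ I, f i (homogenize x) = 0}

namespace IsFacetDescription

lemma dual_nonneg (D : IsFacetDescription P f)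
    {u : homSpan P} (hu : ∀ i, 0 ≤ restrictFunctional P f i u)
    {φ : Dual ℝ ((Fin N → ℝ) × ℝ)} (hφ : ∀ x ∈ P, 0 ≤ φ (homogenize x)) : 0 ≤ φ u := by
  obtain ⟨c, hc, h⟩ := D.generates φ hφ
  rw [h u u.2]
  exact Finset.sum_nonneg fun i _ => mul_nonneg (hc i) (hu i)

lemma isPositiveOn (D : IsFacetDescription P f) :
    IsPositiveOn (restrictFunctional P f) (height P) := by
  intro u hu0 hu
  have h0 : 0 ≤ height P u :=
    D.dual_nonneg hu (φ := LinearMap.snd ℝ _ _) fun x _ => by simp [homogenize]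
  refine lt_of_le_of_ne h0 fun hzero => hu0 (Subtype.ext ?_)
  have key : ∀ φ : Dual ℝ ((Fin N → ℝ) × ℝ), 0 ≤ φ u := by
    intro φ
    have hcont : Continuous fun x : Fin N → ℝ => φ (homogenize x) :=
      (LinearMap.continuous_of_finiteDimensional φ).comp (Continuous.prodMk_left (1 : ℝ))
    obtain ⟨C, hC⟩ := (D.isCompact.image hcont).bddBelow
    have := D.dual_nonneg hu (φ := φ - C • LinearMap.snd ℝ _ _) fun x hx => by
      simpa [homogenize] using hC (mem_image_of_mem _ hx)
    rw [height_apply] at hzero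
    simpa [← hzero] using this
  refine (forall_dual_apply_eq_zero_iff ℝ (u : (Fin N → ℝ) × ℝ)).1 fun φ => ?_
  have := key (-φ)
  rw [LinearMap.neg_apply] at this
  linarith [key φ]

lemma fst_mem (D : IsFacetDescription P f)
    {u : homSpan P} (hu : ∀ i, 0 ≤ restrictFunctional P f i u)
    (h1 : height P u = 1) : (u : (Fin N → ℝ) × ℝ).1 ∈ P := by
  by_contra hcon
  obtain ⟨l, s, hs, hlt⟩ := geometric_hahn_banach_closed_point D.convex D.isCompact.isClosed hcon
  have := D.dual_nonneg hu (φ := s • LinearMap.snd ℝ _ _ -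
    (l : (Fin N → ℝ) →ₗ[ℝ] ℝ).comp (LinearMap.fst ℝ _ _)) fun x hx => by
      simpa [homogenize] using (hs x hx).le
  rw [height_apply] at h1
  simp only [LinearMap.sub_apply, LinearMap.smul_apply, LinearMap.snd_apply, h1,
    LinearMap.comp_apply, LinearMap.fst_apply, smul_eq_mul, mul_one,
    ContinuousLinearMap.coe_coe] at this
  linarith

lemma liftPoint_nonneg (D : IsFacetDescription P f) {x : Fin N → ℝ} (hx : x ∈ P) (i : ι) :
    0 ≤ restrictFunctional P f i (liftPoint hx) := D.nonneg i x hx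

lemma mem_tightFace {x : Fin N → ℝ} (hx : x ∈ P) {I : Finset ι} :
    x ∈ tightFace P f I ↔ slackSupport (restrictFunctional P f) (liftPoint hx) ⊆ I := by
  rw [← mem_tightSpace_iff_subset]
  exact and_iff_right hx

/-- A face consists of the points on which the sum of the functionals outside `I` vanishes. -/
lemma tightFace_eq (D : IsFacetDescription P f) (I : Finset ι) [DecidableEq ι] :
    tightFace P f I = {x ∈ P | (∑ i ∈ Iᶜ, f i) (homogenize x) = 0} := by
  ext x
  refine and_congr_right fun hx => ?_
  rw [LinearMap.sum_apply, Finset.sum_eq_zero_iff_of_nonneg fun i _ => D.nonneg i x hx]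
  simp

lemma isExposed_tightFace (D : IsFacetDescription P f) (I : Finset ι) :
    IsExposed ℝ P (tightFace P f I) := by
  classical
  rcases (tightFace P f I).eq_empty_or_nonempty with h | h
  · rw [h]; exact isExposed_empty
  · refine (isExposed_iff_exists_dual h).2 ⟨∑ i ∈ Iᶜ, f i, fun x hx => ?_, D.tightFace_eq I⟩
    rw [LinearMap.sum_apply]
    exact Finset.sum_nonneg fun i _ => D.nonneg i x hx

lemma vertexSet_tightFace (D : IsFacetDescription P f) (I : Finset ι) :
    vertexSet (tightFace P f I) = (fun u : homSpan P => (u : (Fin N → ℝ) × ℝ).1) ''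
      {u ∈ coneVertices (restrictFunctional P f) (height P) |
        slackSupport (restrictFunctional P f) u ⊆ I} := by
  classical
  ext x
  constructor
  · intro hx
    have hxI : x ∈ tightFace P f I := (IsExposed.subset hx) rfl
    obtain ⟨hxP, -⟩ := id hxI
    obtain ⟨φ, hφ, hφx⟩ := (isExposed_iff_exists_dual (singleton_nonempty x)).1 hx
    have hφ0 : φ (homogenize x) = 0 := (hφx.subset rfl).2
    have hsub := (mem_tightFace hxP).1 hxI
    -- a height zero direction in the smallest face of `x` stays in the face for a while
    have key : ∀ w ∈ tightSpace (restrictFunctional P f)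
        (slackSupport (restrictFunctional P f) (liftPoint hxP)), height P w = 0 →
        ∃ ε : ℝ, 0 < ε ∧ 0 ≤ φ (liftPoint hxP + ε • w : homSpan P) ∧
          (φ (liftPoint hxP + ε • w : homSpan P) = 0 → w = 0) := by
      intro w hw hw0
      obtain ⟨ε, hε, hnn, -⟩ := exists_pos_add_smul_nonneg (D.liftPoint_nonneg hxP) (w := w)
        fun i hi => (hw i (notMem_slackSupport.2 hi)).ge
      have h1 : height P (liftPoint hxP + ε • w) = 1 := by
        rw [map_add, map_smul, hw0, smul_zero, add_zero]; rfl
      have hy := D.fst_mem hnn h1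
      have hyI : ((liftPoint hxP + ε • w : homSpan P) : (Fin N → ℝ) × ℝ).1 ∈ tightFace P f I := by
        refine ⟨hy, fun i hi => ?_⟩
        rw [homogenize_fst h1]
        have := add_mem (mem_tightSpace_iff_subset.2 subset_rfl) (Submodule.smul_mem _ ε hw)
        exact tightSpace_mono hsub this i hi
      refine ⟨ε, hε, ?_, fun h0 => ?_⟩
      · have := hφ _ hyI
        rwa [homogenize_fst h1] at this
      · have hmem := hφx.superset ⟨hyI, by rwa [homogenize_fst h1]⟩
        have heq : liftPoint hxP + ε • w = liftPoint hxP := by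
          refine Subtype.ext ?_
          rw [← homogenize_fst h1, mem_singleton_iff.1 hmem]
          rfl
        have := add_eq_left.1 heq
        exact (smul_eq_zero.1 this).resolve_left hε.ne'
    have hzero : ∀ w ∈ tightSpace (restrictFunctional P f)
        (slackSupport (restrictFunctional P f) (liftPoint hxP)), height P w = 0 → w = 0 := by
      intro w hw hw0
      obtain ⟨ε, hε, h₁, h₂⟩ := key w hw hw0
      obtain ⟨δ, hδ, h₃, -⟩ := key (-w) (neg_mem hw) (by rw [map_neg, hw0, neg_zero])
      refine h₂ ?_
      simp only [Submodule.coe_add, Submodule.coe_smul, Submodule.coe_neg, coe_liftPoint, map_add,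
        map_smul, map_neg, hφ0, zero_add, smul_eq_mul] at h₁ h₃ ⊢
      have h₄ : 0 ≤ φ w := nonneg_of_mul_nonneg_right h₁ hε
      have h₅ : 0 ≤ -φ w := nonneg_of_mul_nonneg_right h₃ hδ
      have h₆ : φ w = 0 := by linarith
      rw [h₆, mul_zero]
    refine ⟨liftPoint hxP, ⟨⟨D.liftPoint_nonneg hxP, rfl, fun w hw => ⟨height P w, ?_⟩⟩, hsub⟩, rfl⟩
    have := hzero (w - height P w • liftPoint hxP)
      (sub_mem hw (Submodule.smul_mem _ _ (mem_tightSpace_iff_subset.2 subset_rfl))) (by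
        have : height P (liftPoint hxP) = 1 := rfl
        rw [map_sub, map_smul, this, smul_eq_mul, mul_one, sub_self])
    exact sub_eq_zero.1 this
  · rintro ⟨u, ⟨⟨hu, h1, huniq⟩, hsub⟩, rfl⟩
    have huP := D.fst_mem hu h1
    have hlift : liftPoint huP = u := Subtype.ext (homogenize_fst h1)
    have hface : {(u : (Fin N → ℝ) × ℝ).1} =
        tightFace P f (slackSupport (restrictFunctional P f) u) := by
      ext y
      constructor
      · rintro rfl
        exact (mem_tightFace huP).2 (by rw [hlift])
      · intro hy
        obtain ⟨c, hc⟩ := huniq (liftPoint hy.1) fun i hi => hy.2 i hi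
        have h2 := congrArg (height P) hc
        have h3 : height P (liftPoint hy.1) = 1 := rfl
        rw [map_smul, h1, h3, smul_eq_mul, mul_one] at h2
        rw [← h2, one_smul] at hc
        rw [← hc]
        rfl
    show IsExposed ℝ _ {_}
    have hle : {(u : (Fin N → ℝ) × ℝ).1} ⊆ tightFace P f I := by
      rw [singleton_subset_iff]
      exact (mem_tightFace huP).2 (by rw [hlift]; exact hsub)
    have hexp : IsExposed ℝ P {(u : (Fin N → ℝ) × ℝ).1} := hface ▸ D.isExposed_tightFace _
    intro hne
    obtain ⟨l, hl⟩ := hexp hne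
    refine ⟨l, subset_antisymm (fun y hy => ?_) fun y hy => ?_⟩
    · exact ⟨hle hy, fun z hz => (hl.subset hy).2 z hz.1⟩
    · have hu' := hl.subset (mem_singleton _)
      exact hl.superset ⟨hy.1.1, fun z hz => (hu'.2 z hz).trans (hy.2 _ (hle rfl))⟩

lemma ncard_vertexSet_tightFace (D : IsFacetDescription P f) (I : Finset ι) :
    (vertexSet (tightFace P f I)).ncard =
      {u ∈ coneVertices (restrictFunctional P f) (height P) |
        slackSupport (restrictFunctional P f) u ⊆ I}.ncard := by
  rw [D.vertexSet_tightFace I]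
  refine InjOn.ncard_image ?_
  rintro u ⟨⟨-, hu, -⟩, -⟩ v ⟨⟨-, hv, -⟩, -⟩ huv
  exact Subtype.ext (Prod.ext huv (hu.trans hv.symm))

lemma nonempty_tightFace_and_finrank (D : IsFacetDescription P f) {p : homSpan P} (hp0 : p ≠ 0)
    (hp : ∀ i, 0 ≤ restrictFunctional P f i p) :
    (tightFace P f (slackSupport (restrictFunctional P f) p)).Nonempty ∧
    pdim (tightFace P f (slackSupport (restrictFunctional P f) p)) + 1 =
      finrank ℝ (tightSpace (restrictFunctional P f)
        (slackSupport (restrictFunctional P f) p)) := by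
  set I := slackSupport (restrictFunctional P f) p with hI
  have norm : ∀ q : homSpan P, q ≠ 0 → (∀ i, 0 ≤ restrictFunctional P f i q) →
      q ∈ tightSpace (restrictFunctional P f) I →
      ∃ x ∈ tightFace P f I, ∃ c : ℝ, (q : (Fin N → ℝ) × ℝ) = c • homogenize x := by
    intro q hq0 hq hqI
    have hpos := D.isPositiveOn q hq0 hq
    have h1 : height P ((height P q)⁻¹ • q) = 1 := by
      rw [map_smul, smul_eq_mul, inv_mul_cancel₀ hpos.ne']
    have hmem := D.fst_mem (u := (height P q)⁻¹ • q) (fun i => by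
      rw [map_smul]; exact mul_nonneg (inv_nonneg.2 hpos.le) (hq i)) h1
    have hhom := homogenize_fst h1
    refine ⟨_, ⟨hmem, fun i hi => ?_⟩, height P q, ?_⟩
    · rw [hhom]
      exact (Submodule.smul_mem _ (height P q)⁻¹ hqI) i hi
    · rw [hhom, Submodule.coe_smul, smul_smul, mul_inv_cancel₀ hpos.ne', one_smul]
  have hpI : p ∈ tightSpace (restrictFunctional P f) I :=
    mem_tightSpace_iff_subset.2 subset_rfl
  obtain ⟨x, hx, -⟩ := norm p hp0 hp hpI
  refine ⟨⟨x, hx⟩, ?_⟩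
  have hmem : ∀ q : homSpan P, (∀ i, 0 ≤ restrictFunctional P f i q) →
      q ∈ tightSpace (restrictFunctional P f) I →
      (q : (Fin N → ℝ) × ℝ) ∈ homSpan (tightFace P f I) := by
    intro q hq hqI
    by_cases hq0 : q = 0
    · rw [hq0]; exact zero_mem _
    · obtain ⟨y, hy, c, hc⟩ := norm q hq0 hq hqI
      rw [hc]
      exact Submodule.smul_mem _ _ (homogenize_mem_homSpan hy)
  have hspan : homSpan (tightFace P f I) =
      (tightSpace (restrictFunctional P f) I).map (homSpan P).subtype := by
    apply le_antisymm
    · exact homSpan_le.2 fun y hy => ⟨liftPoint hy.1, fun i hi => hy.2 i hi, rfl⟩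
    · rintro _ ⟨w, hw, rfl⟩
      obtain ⟨ε, hε, hnn, -⟩ := exists_pos_add_smul_nonneg hp (w := w)
        fun i hi => (hw i (notMem_slackSupport.2 hi)).ge
      have h₁ := hmem _ hnn (add_mem hpI (Submodule.smul_mem _ ε hw))
      have h₂ := Submodule.smul_mem _ ε⁻¹ (sub_mem h₁ (hmem p hp hpI))
      simpa [hε.ne'] using h₂
  rw [← finrank_homSpan ⟨x, hx⟩, hspan,
    LinearEquiv.finrank_eq (Submodule.equivSubtypeMap (homSpan P)
      (tightSpace (restrictFunctional P f) I)).symm]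

lemma isTwoSimplicialCone (D : IsFacetDescription P f) (hs : TwoSimplicial P) :
    IsTwoSimplicialCone (restrictFunctional P f) (height P) := by
  intro p hp h3
  have hp0 : p ≠ 0 := by
    rintro rfl
    have : tightSpace (restrictFunctional P f)
        (slackSupport (restrictFunctional P f) (0 : homSpan P)) = ⊥ := by
      refine (Submodule.eq_bot_iff _).2 fun w hw => D.isPositiveOn.eq_zero fun i => hw i ?_
      exact notMem_slackSupport.2 (map_zero _)
    rw [this, finrank_bot] at h3
    omega
  obtain ⟨hne, hdim⟩ := D.nonempty_tightFace_and_finrank hp0 hp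
  rw [← D.ncard_vertexSet_tightFace]
  exact hs _ (D.isExposed_tightFace _) hne (by omega)

end IsFacetDescription

end FacetDescription

/-- For every integer `d ≥ 3`, every 2-simplicial `d`-polytope with at least `d + 3`
vertices has at least `d + 4` facets. -/
theorem two_simplicial_facet_bound
    (d : ℕ) (hd : 3 ≤ d) {N : ℕ} (P : Set (Fin N → ℝ))
    (hP : IsPolytope P) (hdim : pdim P = d) (hs : TwoSimplicial P)
    (hv : d + 3 ≤ (vertexSet P).ncard) :
    d + 4 ≤ (facetSet P).ncard := by
  obtain ⟨S, hS⟩ := hP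
  have hPne : P.Nonempty := by
    rw [nonempty_iff_ne_empty]
    rintro rfl
    rw [pdim, direction_affineSpan, vectorSpan_empty, finrank_bot] at hdim
    omega
  have hfin : (facetSet P).Finite :=
    (finite_setOf_isExposed (S := S)).subset fun F hF => hS ▸ hF.1
  have := hfin.fintype
  choose f hf hfF using fun F : facetSet P => (isExposed_iff_exists_dual F.2.2.1).1 F.2.1
  have D : IsFacetDescription P f :=
    { isCompact := hS ▸ Set.Finite.isCompact_convexHull ℝ S.finite_toSet
      convex := hS ▸ convex_convexHull ℝ _
      nonneg := hf
      generates := exists_nonneg_combination_facets hS (by omega) f hf hfF }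
  have hrank : Module.finrank ℝ (homSpan P) = d + 1 := by rw [finrank_homSpan hPne, hdim]
  have huniv : tightFace P f Finset.univ = P := by
    ext x; simp [tightFace]
  have hcount := D.ncard_vertexSet_tightFace Finset.univ
  simp only [huniv, Finset.subset_univ, and_true, ofPred_mem_eq] at hcount
  by_contra! hlt
  have := ncard_coneVertices_le D.isPositiveOn (D.isTwoSimplicialCone hs)
    (by rw [hrank, fintypeCard_eq_ncard]; omega) (by omega)
  omega
end
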